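/- Let Δ and Δ′ be integers such that Δ, Δ′, and ΔΔ′ are all non-squares. Define g on squarefree natural numbers by g(n) = ∑_{p ∣ n, p odd prime, p ∤ Δ} ((Δ′/p) − (Δ/p))/2, where (·/p) is the Legendre symbol. Then for every real z, the proportion |{n ≤ x : n squarefree and g(n) ≤ z·√((1/2)·log log x)}| / |{n ≤ x : n squarefree}| converges, as x → ∞, to G(z) = (1/√(2π)) ∫_{−∞}^{z} e^{−w²/2} dw. -/

import Mathlib

/-- Summing over the multiples of `m` up to `x` amounts to summing up to `x / m`. -/
lemma sum_Ioc_ite_dvd {M : Type*} [AddCommMonoid M] (W : ℕ → M) {m : ℕ} (hm : 0 < m) (N : ℕ) :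
    ∑ n ∈ Finset.Ioc 0 N, (if m ∣ n then W n else 0) =
      ∑ k ∈ Finset.Ioc 0 (N / m), W (m * k) := by
  rw [← Finset.sum_filter]
  symm
  refine Finset.sum_bij' (fun k _ ↦ m * k) (fun n _ ↦ n / m) ?_ ?_ ?_ ?_ ?_
  · intro k hk
    simp only [Finset.mem_Ioc, Finset.mem_filter] at hk ⊢
    have := (Nat.le_div_iff_mul_le hm).1 hk.2
    exact ⟨⟨Nat.mul_pos hm hk.1, by rwa [mul_comm]⟩, dvd_mul_right _ _⟩
  · intro n hn
    simp only [Finset.mem_Ioc, Finset.mem_filter] at hn ⊢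
    exact ⟨Nat.div_pos (Nat.le_of_dvd hn.1.1 hn.2) hm, Nat.div_le_div_right hn.1.2⟩
  · intro k _
    exact Nat.mul_div_cancel_left k hm
  · intro n hn
    exact Nat.mul_div_cancel' (Finset.mem_filter.1 hn).2
  · intros; rfl

/-- The local factor of a multiplicative function at `p`: it is `1`, `1 + A p`, `1 + A p + B p`
according to whether `p` divides `n` not at all, exactly once, or at least twice. -/
noncomputable def localFactor (A B : ℕ → ℂ) (p n : ℕ) : ℂ :=
  1 + (if p ∣ n then A p else 0) + (if p ^ 2 ∣ n then B p else 0)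

lemma localFactor_mul_left (A B : ℕ → ℂ) {p m : ℕ} (h : p.Coprime m) (n : ℕ) :
    localFactor A B p (m * n) = localFactor A B p n := by
  simp only [localFactor, h.dvd_mul_left, (h.pow_left 2).dvd_mul_left]

lemma abs_floor_sub_le_rpow {x ε : ℝ} (hx : 0 ≤ x) (h0 : 0 ≤ ε) (h1 : ε ≤ 1) :
    |(⌊x⌋₊ : ℝ) - x| ≤ x ^ (1 - ε) := by
  rcases le_or_gt 1 x with h | h
  · have : (1 : ℝ) ≤ x ^ (1 - ε) := Real.one_le_rpow h (by linarith)
    have h2 := Nat.floor_le hx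
    have h3 := Nat.lt_floor_add_one x
    rw [abs_le]; constructor <;> linarith
  · rw [Nat.floor_eq_zero.2 h, Nat.cast_zero, zero_sub, abs_neg, abs_of_nonneg hx]
    rcases hx.eq_or_lt with rfl | hx
    · positivity
    · simpa using Real.rpow_le_rpow_of_exponent_ge hx h.le (show 1 - ε ≤ 1 by linarith)

/-- Mean values of multiplicative functions determined by finitely many primes, with an error
term controlled by Rankin's trick. -/
theorem norm_sum_prod_localFactor_sub_le (A B : ℕ → ℂ) {ε : ℝ} (h0 : 0 ≤ ε) (h1 : ε ≤ 1)
    (P : Finset ℕ) (hP : ∀ p ∈ P, p.Prime) {x : ℝ} (hx : 0 ≤ x) :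
    ‖∑ n ∈ Finset.Ioc 0 ⌊x⌋₊, ∏ p ∈ P, localFactor A B p n -
        x * ∏ p ∈ P, (1 + A p / p + B p / p ^ 2)‖ ≤
      x ^ (1 - ε) * ∏ p ∈ P, (1 + ‖A p‖ * (p : ℝ) ^ (ε - 1) + ‖B p‖ * ((p : ℝ) ^ (ε - 1)) ^ 2) := by
  induction P using Finset.induction_on generalizing x with
  | empty =>
    have := abs_floor_sub_le_rpow hx h0 h1
    simp only [Finset.prod_empty, Finset.sum_const, Nat.card_Ioc, mul_one]
    rw [← Real.norm_eq_abs, ← Complex.norm_real] at this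
    simpa using this
  | insert q P hq ih =>
    have hqp : q.Prime := hP q (Finset.mem_insert_self _ _)
    have hP' : ∀ p ∈ P, p.Prime := fun p hp ↦ hP p (Finset.mem_insert_of_mem hp)
    have hcop : ∀ p ∈ P, p.Coprime q := fun p hp ↦
      (Nat.coprime_primes (hP' p hp) hqp).2 (by rintro rfl; exact hq hp)
    have hq0 : (0 : ℝ) < q := by exact_mod_cast hqp.pos
    set W : ℕ → ℂ := fun n ↦ ∏ p ∈ P, localFactor A B p n with hW
    set M : ℂ := ∏ p ∈ P, (1 + A p / p + B p / p ^ 2) with hM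
    set E : ℝ := ∏ p ∈ P,
      (1 + ‖A p‖ * (p : ℝ) ^ (ε - 1) + ‖B p‖ * ((p : ℝ) ^ (ε - 1)) ^ 2) with hE
    set T : ℝ → ℂ := fun x ↦ ∑ n ∈ Finset.Ioc 0 ⌊x⌋₊, W n with hT
    have hWq : ∀ m : ℕ, (∀ p ∈ P, p.Coprime m) → ∀ n, W (m * n) = W n := fun m hm n ↦
      Finset.prod_congr rfl fun p hp ↦ localFactor_mul_left A B (hm p hp) n
    have hTq : ∀ m : ℕ, 0 < m → (∀ p ∈ P, p.Coprime m) →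
        ∑ n ∈ Finset.Ioc 0 ⌊x⌋₊, (if m ∣ n then W n else 0) = T (x / m) := by
      intro m hm hc
      rw [sum_Ioc_ite_dvd W hm, hT]
      simp only [Nat.floor_div_natCast]
      exact Finset.sum_congr rfl fun n _ ↦ hWq m hc n
    have hsum : ∑ n ∈ Finset.Ioc 0 ⌊x⌋₊, ∏ p ∈ insert q P, localFactor A B p n =
        T x + A q * T (x / q) + B q * T (x / (q ^ 2 : ℕ)) := by
      rw [← hTq q hqp.pos hcop, ← hTq (q ^ 2) (pow_pos hqp.pos 2)
        fun p hp ↦ (hcop p hp).pow_right 2, hT, Finset.mul_sum, Finset.mul_sum,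
        ← Finset.sum_add_distrib, ← Finset.sum_add_distrib]
      refine Finset.sum_congr rfl fun n _ ↦ ?_
      rw [Finset.prod_insert hq, localFactor]
      simp only [hW]
      split_ifs <;> ring
    have e0 := ih hP' hx
    have e1 := ih hP' (x := x / q) (by positivity)
    have e2 := ih hP' (x := x / (q ^ 2 : ℕ)) (by positivity)
    have r1 : (x / q) ^ (1 - ε) = x ^ (1 - ε) * (q : ℝ) ^ (ε - 1) := by
      rw [Real.div_rpow hx hq0.le, div_eq_mul_inv, ← Real.rpow_neg hq0.le, neg_sub]
    have r2 : (x / (q ^ 2 : ℕ)) ^ (1 - ε) = x ^ (1 - ε) * ((q : ℝ) ^ (ε - 1)) ^ 2 := by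
      rw [Real.div_rpow hx (by positivity), div_eq_mul_inv, ← Real.rpow_neg (by positivity),
        neg_sub, Nat.cast_pow, ← Real.rpow_natCast, ← Real.rpow_mul hq0.le,
        ← Real.rpow_natCast, ← Real.rpow_mul hq0.le, mul_comm (ε - 1)]
    rw [r1] at e1
    rw [r2] at e2
    rw [hsum, Finset.prod_insert hq, Finset.prod_insert hq]
    have key : T x + A q * T (x / q) + B q * T (x / (q ^ 2 : ℕ)) -
        x * ((1 + A q / q + B q / q ^ 2) * M) =
        (T x - x * M) + A q * (T (x / q) - (x / q : ℝ) * M) +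
          B q * (T (x / (q ^ 2 : ℕ)) - (x / (q ^ 2 : ℕ) : ℝ) * M) := by
      push_cast; ring
    rw [key]
    calc _ ≤ ‖T x - x * M‖ + ‖A q‖ * ‖T (x / q) - (x / q : ℝ) * M‖ +
          ‖B q‖ * ‖T (x / (q ^ 2 : ℕ)) - (x / (q ^ 2 : ℕ) : ℝ) * M‖ := by
          refine (norm_add_le _ _).trans ?_
          rw [norm_mul]
          gcongr
          refine (norm_add_le _ _).trans ?_
          rw [norm_mul]
      _ ≤ x ^ (1 - ε) * E + ‖A q‖ * (x ^ (1 - ε) * (q : ℝ) ^ (ε - 1) * E) +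
          ‖B q‖ * (x ^ (1 - ε) * ((q : ℝ) ^ (ε - 1)) ^ 2 * E) := by
          gcongr
      _ = _ := by ring

open scoped NumberTheorySymbols in
/-- A nonsquare integer has Jacobi symbol `-1` modulo some odd prime. -/
lemma exists_prime_jacobiSym_eq_neg_one {a : ℤ} (ha : ¬ IsSquare a) :
    ∃ p : ℕ, p.Prime ∧ Odd p ∧ p.Coprime a.natAbs ∧ J(a | p) = -1 := by
  have ha0 : a ≠ 0 := by rintro rfl; exact ha ⟨0, by simp⟩
  obtain ⟨s, k, hsk, hs⟩ := Nat.sq_mul_squarefree a.natAbs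
  have hn0 : a.natAbs ≠ 0 := Int.natAbs_ne_zero.2 ha0
  have hs0 : s ≠ 0 := hs.ne_zero
  have hk0 : k ≠ 0 := by rintro rfl; simp at hsk; omega
  -- reduce to the squarefree part
  obtain ⟨u, hu, hau⟩ : ∃ u : ℤ, (u = 1 ∨ u = -1) ∧ a = u * s * (k : ℤ) ^ 2 := by
    rcases Int.natAbs_eq a with h | h
    · exact ⟨1, .inl rfl, by rw [h, ← hsk]; push_cast; ring⟩
    · exact ⟨-1, .inr rfl, by rw [h, ← hsk]; push_cast; ring⟩
  have hcop : ∀ p : ℕ, p.Prime → a.natAbs < p → p.Coprime a.natAbs := fun p hp hlt ↦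
    (Nat.Prime.coprime_iff_not_dvd hp).2 fun h ↦ by
      have := Nat.le_of_dvd (Nat.pos_of_ne_zero hn0) h; omega
  have hred : ∀ p : ℕ, p.Prime → a.natAbs < p → J(a | p) = J(u * s | p) := by
    intro p hp hlt
    have : Int.gcd (k : ℤ) p = 1 := by
      rw [Int.gcd_natCast_natCast]
      exact (((hcop p hp hlt).symm).coprime_dvd_left ⟨k * s, by rw [← hsk]; ring⟩)
    rw [hau, jacobiSym.mul_left, jacobiSym.sq_one' this, mul_one]
  by_cases hq : ∃ q : ℕ, q.Prime ∧ q ≠ 2 ∧ q ∣ s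
  · obtain ⟨q, hqp, hq2, s', rfl⟩ := hq
    have hqs' : q.Coprime s' := Nat.coprime_of_squarefree_mul hs
    have hs'0 : s' ≠ 0 := by rintro rfl; simp at hs0
    have := Fact.mk hqp
    have hqodd : Odd q := hqp.odd_of_ne_two hq2
    obtain ⟨r, hr⟩ := FiniteField.exists_nonsquare (F := ZMod q) (by rwa [ZMod.ringChar_zmod_n])
    have hcop8 : Nat.Coprime (8 * s') q :=
      Nat.Coprime.mul_left (Nat.Coprime.pow_left 3 (Nat.coprime_two_left.2 hqodd)) hqs'.symm
    obtain ⟨m, hm1, hm2⟩ := Nat.chineseRemainder hcop8 1 r.val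
    have hr0 : r ≠ 0 := by rintro rfl; exact hr ⟨0, by simp⟩
    have hmcop : Nat.Coprime m (8 * s' * q) := by
      refine Nat.Coprime.mul_right ?_ ?_
      · rw [Nat.Coprime, hm1.gcd_eq]; simp
      · rw [Nat.Coprime, hm2.gcd_eq]
        exact (ZMod.isUnit_iff_coprime r.val q).1 (by simpa using hr0)
    obtain ⟨p, hpgt, hp, hpm⟩ := Nat.forall_exists_prime_gt_and_modEq a.natAbs
      (q := 8 * s' * q) (a := m) (by simp [hs'0, hqp.ne_zero]) hmcop
    have hp1 : p ≡ 1 [MOD 8 * s'] := (hpm.of_mul_right q).trans hm1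
    have hp2 : p ≡ r.val [MOD q] := (hpm.of_mul_left (8 * s')).trans hm2
    have hp8 : p % 8 = 1 := hp1.of_mul_right s'
    have hpodd : Odd p := Nat.odd_iff.2 (by omega)
    refine ⟨p, hp, hpodd, hcop p hp hpgt, ?_⟩
    rw [hred p hp hpgt]
    have hsplit : u * ((q * s' : ℕ) : ℤ) = (u * s') * (q : ℤ) := by push_cast; ring
    have e1 : J(u * s' | p) = 1 := by
      have hnat : (u * s' : ℤ).natAbs = s' := by rcases hu with rfl | rfl <;> simp
      rw [jacobiSym.mod_right _ hpodd, hnat]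
      have hlt : 1 < 4 * s' := by omega
      have hp4 : p ≡ 1 [MOD 4 * s'] := hp1.of_dvd ⟨2, by ring⟩
      rw [show p % (4 * s') = 1 by rw [hp4, Nat.mod_eq_of_lt hlt], jacobiSym.one_right]
    have e2 : J(q | p) = -1 := by
      rw [jacobiSym.quadratic_reciprocity_one_mod_four' hqodd (by omega),
        ZMod.nonsquare_iff_jacobiSym_eq_neg_one]
      have : ((p : ℤ) : ZMod q) = r := by
        rw [Int.cast_natCast, (ZMod.natCast_eq_natCast_iff _ _ _).2 hp2, ZMod.natCast_zmod_val]
      rwa [this]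
    rw [hsplit, jacobiSym.mul_left, e1, e2, one_mul]
  · push Not at hq
    have hs12 : s = 1 ∨ s = 2 := by
      have h2 : s ∣ 2 := by
        rw [← Nat.prod_primeFactors_of_squarefree hs]
        have hsub : s.primeFactors ⊆ {2} := fun p hp ↦ by
          have hp' := Nat.mem_primeFactors.1 hp
          by_contra h
          exact hq p hp'.1 (by simpa using h) hp'.2.1
        simpa using Finset.prod_dvd_prod_of_subset _ _ (fun p : ℕ ↦ p) hsub
      exact (Nat.dvd_prime Nat.prime_two).1 h2
    have hmod : ∀ c : ℕ, c.Coprime 8 → ∃ p : ℕ, p.Prime ∧ a.natAbs < p ∧ p % 8 = c % 8 := by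
      intro c hc
      obtain ⟨p, h1, h2, h3⟩ := Nat.forall_exists_prime_gt_and_modEq a.natAbs
        (q := 8) (a := c) (by norm_num) hc
      exact ⟨p, h2, h1, h3⟩
    rcases hs12 with rfl | rfl
    · rcases hu with rfl | rfl
      · exact absurd ⟨(k : ℤ), by rw [hau]; push_cast; ring⟩ ha
      · obtain ⟨p, hp, hgt, h8⟩ := hmod 7 (by decide)
        have hpodd : Odd p := Nat.odd_iff.2 (by omega)
        refine ⟨p, hp, hpodd, hcop p hp hgt, ?_⟩
        rw [hred p hp hgt, Nat.cast_one, mul_one, jacobiSym.at_neg_one hpodd,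
          ZMod.χ₄_nat_three_mod_four (by omega)]
    · obtain ⟨p, hp, hgt, h8⟩ := hmod 5 (by decide)
      have hpodd : Odd p := Nat.odd_iff.2 (by omega)
      refine ⟨p, hp, hpodd, hcop p hp hgt, ?_⟩
      have hp5 : (p : ZMod 8) = (5 : ℕ) := (ZMod.natCast_eq_natCast_iff' p 5 8).2 h8
      rw [hred p hp hgt]
      rcases hu with rfl | rfl
      · rw [one_mul, Nat.cast_two, jacobiSym.at_two hpodd, hp5]; decide
      · rw [Nat.cast_two, show (-1 * 2 : ℤ) = -2 by norm_num, jacobiSym.at_neg_two hpodd, hp5]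
        decide

open scoped NumberTheorySymbols in
open scoped Classical in
/-- The Jacobi symbol `J(a | ·)` as a Dirichlet character modulo `4 * |a|`. -/
noncomputable def jacobiCharacter (a : ℤ) (ha : a ≠ 0) :
    DirichletCharacter ℂ (4 * a.natAbs) where
  toFun x := if IsUnit x then (J(a | x.val) : ℂ) else 0
  map_one' := by
    have : 1 < 4 * a.natAbs := by omega
    have := Fact.mk this
    simp [ZMod.val_one]
  map_mul' x y := by
    have : NeZero (4 * a.natAbs) := ⟨by omega⟩
    by_cases hx : IsUnit x
    · by_cases hy : IsUnit y
      · have hodd : ∀ z : ZMod (4 * a.natAbs), IsUnit z → Odd z.val := by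
          intro z hz
          rw [← ZMod.natCast_zmod_val z, ZMod.isUnit_iff_coprime] at hz
          exact Nat.coprime_two_right.1 (hz.coprime_dvd_right ⟨2 * a.natAbs, by ring⟩)
        have hx' := hodd x hx
        have hy' := hodd y hy
        simp only [hx, hy, hx.mul hy, if_true]
        rw [ZMod.val_mul, ← jacobiSym.mod_right a (hx'.mul hy'),
          jacobiSym.mul_right' a hx'.pos.ne' hy'.pos.ne', Int.cast_mul]
      · have : ¬ IsUnit (x * y) := fun h ↦ hy (isUnit_of_mul_isUnit_right h)
        simp [hy, this]
    · have : ¬ IsUnit (x * y) := fun h ↦ hx (isUnit_of_mul_isUnit_left h)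
      simp [hx, this]
  map_nonunit' x hx := by simp [hx]

open scoped NumberTheorySymbols in
lemma jacobiCharacter_apply {a : ℤ} (ha : a ≠ 0) {n : ℕ} (hn : Odd n)
    (hc : n.Coprime a.natAbs) : jacobiCharacter a ha n = (J(a | n) : ℂ) := by
  have hu : IsUnit (n : ZMod (4 * a.natAbs)) := by
    rw [ZMod.isUnit_iff_coprime]
    exact Nat.Coprime.mul_right (Nat.Coprime.pow_right 2 (Nat.coprime_two_right.2 hn)) hc
  refine (if_pos hu).trans ?_
  rw [ ZMod.val_natCast, ← jacobiSym.mod_right a hn]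

lemma jacobiCharacter_ne_one {a : ℤ} (ha : ¬ IsSquare a) (ha0 : a ≠ 0) :
    jacobiCharacter a ha0 ≠ 1 := by
  obtain ⟨p, -, hodd, hc, hJ⟩ := exists_prime_jacobiSym_eq_neg_one ha
  intro h
  have h1 := jacobiCharacter_apply ha0 hodd hc
  have hu : IsUnit (p : ZMod (4 * a.natAbs)) := by
    rw [ZMod.isUnit_iff_coprime]
    exact Nat.Coprime.mul_right (Nat.Coprime.pow_right 2 (Nat.coprime_two_right.2 hodd)) hc
  rw [h, hJ, MulChar.one_apply hu] at h1
  norm_num at h1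

lemma Nat.Primes.summable_rpow_neg_one_add {δ : ℝ} (hδ : 0 < δ) :
    Summable fun p : Nat.Primes ↦ (p : ℝ) ^ (-(1 + δ)) :=
  Nat.Primes.summable_rpow.2 (by linarith)

/-- The prime sum `∑ Re χ(p) p ^ (-1 - δ)` is `log |L(χ, 1 + δ)|` up to a bounded error. -/
lemma abs_tsum_primes_sub_log_norm_LFunction_le {N : ℕ} [NeZero N] (χ : DirichletCharacter ℂ N)
    {δ : ℝ} (hδ : 0 < δ) :
    |∑' p : Nat.Primes, (χ p).re * (p : ℝ) ^ (-(1 + δ)) -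
      Real.log ‖DirichletCharacter.LFunction χ (1 + δ : ℝ)‖| ≤
      ∑' p : Nat.Primes, (p : ℝ) ^ (-2 : ℝ) := by
  set s : ℂ := ((1 + δ : ℝ) : ℂ) with hs
  have hs1 : 1 < s.re := by rw [hs, Complex.ofReal_re]; linarith
  have hexp := DirichletCharacter.LSeries_eulerProduct_exp_log χ hs1
  rw [← DirichletCharacter.LFunction_eq_LSeries χ hs1] at hexp
  rw [← hexp, Complex.norm_exp, Real.log_exp]
  set z : Nat.Primes → ℂ := fun p ↦ χ p * (p : ℂ) ^ (-s) with hz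
  have hcp : ∀ p : Nat.Primes, (p : ℂ) ^ (-s) = (((p : ℝ) ^ (-(1 + δ)) : ℝ) : ℂ) := by
    intro p
    rw [Complex.ofReal_cpow (by positivity), hs]
    push_cast; rfl
  have hp2 : ∀ p : Nat.Primes, (2 : ℝ) ≤ p := fun p ↦ by exact_mod_cast p.2.two_le
  have hzn : ∀ p, ‖z p‖ ≤ (p : ℝ) ^ (-(1 + δ)) := by
    intro p
    rw [hz]; simp only
    rw [norm_mul, hcp, Complex.norm_real, Real.norm_of_nonneg (by positivity)]
    exact mul_le_of_le_one_left (by positivity) (χ.norm_le_one _)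
  have hzn1 : ∀ p, ‖z p‖ ≤ (p : ℝ)⁻¹ := fun p ↦ (hzn p).trans <| by
    rw [← Real.rpow_neg_one]
    exact Real.rpow_le_rpow_of_exponent_le (by linarith [hp2 p]) (by linarith)
  have hhalf : ∀ p, ‖z p‖ ≤ 1 / 2 := fun p ↦ (hzn1 p).trans <| by
    rw [one_div]; exact inv_anti₀ (by norm_num) (hp2 p)
  have hd : ∀ p, ‖-Complex.log (1 - z p) - z p‖ ≤ (p : ℝ) ^ (-2 : ℝ) := by
    intro p
    have h1 := Complex.norm_log_one_add_sub_self_le (z := -z p)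
      (by rw [norm_neg]; linarith [hhalf p])
    rw [norm_neg, ← sub_eq_add_neg] at h1
    have h2 : (1 - ‖z p‖)⁻¹ ≤ 2 := by
      rw [inv_le_comm₀ (by linarith [hhalf p]) (by norm_num)]
      linarith [hhalf p]
    calc _ = ‖Complex.log (1 - z p) - -z p‖ := by rw [← norm_neg]; congr 1; ring
      _ ≤ _ := h1
      _ ≤ ‖z p‖ ^ 2 * 2 / 2 := by gcongr
      _ = ‖z p‖ ^ 2 := by ring
      _ ≤ ((p : ℝ)⁻¹) ^ 2 := by gcongr; exact hzn1 p
      _ = _ := by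
        rw [← Real.rpow_neg_one, ← Real.rpow_natCast, ← Real.rpow_mul (by positivity)]
        norm_num
  have hsum2 : Summable fun p : Nat.Primes ↦ (p : ℝ) ^ (-2 : ℝ) :=
    Nat.Primes.summable_rpow.2 (by norm_num)
  have hsz : Summable z := Summable.of_norm_bounded
    (Nat.Primes.summable_rpow_neg_one_add hδ) hzn
  have hsd : Summable fun p ↦ -Complex.log (1 - z p) - z p := Summable.of_norm_bounded hsum2 hd
  have hsl : Summable fun p ↦ -Complex.log (1 - z p) := by
    simpa using hsd.add hsz
  have hre : ∀ p : Nat.Primes, (χ p).re * (p : ℝ) ^ (-(1 + δ)) = (z p).re := by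
    intro p
    rw [hz]; simp only
    rw [hcp, Complex.re_mul_ofReal]
  rw [tsum_congr hre, ← Complex.re_tsum hsz, abs_sub_comm, ← Complex.sub_re, ← hsl.tsum_sub hsz]
  exact (Complex.abs_re_le_norm _).trans (tsum_of_norm_bounded hsum2.hasSum hd)

/-- The logarithm of the norm of a nonvanishing continuous function is bounded on `(0, 1]`. -/
lemma exists_abs_log_norm_le {F : ℝ → ℂ} (hF : ContinuousOn F (Set.Icc 0 1))
    (h0 : ∀ δ ∈ Set.Icc (0 : ℝ) 1, F δ ≠ 0) :
    ∃ C, ∀ δ ∈ Set.Icc (0 : ℝ) 1, |Real.log ‖F δ‖| ≤ C :=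
  isCompact_Icc.exists_bound_of_continuousOn
    (hF.norm.log fun δ hδ ↦ norm_ne_zero_iff.2 (h0 δ hδ))

lemma exists_abs_tsum_primes_dirichletCharacter_le {N : ℕ} [NeZero N]
    {χ : DirichletCharacter ℂ N} (hχ : χ ≠ 1) :
    ∃ C, ∀ δ ∈ Set.Ioc (0 : ℝ) 1,
      |∑' p : Nat.Primes, (χ p).re * (p : ℝ) ^ (-(1 + δ))| ≤ C := by
  obtain ⟨C, hC⟩ := exists_abs_log_norm_le
    (F := fun δ ↦ DirichletCharacter.LFunction χ (1 + δ : ℝ))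
    ((DirichletCharacter.differentiable_LFunction hχ).continuous.comp
      (by fun_prop)).continuousOn
    (fun δ hδ ↦ DirichletCharacter.LFunction_ne_zero_of_one_le_re χ (.inl hχ)
      (by rw [Complex.ofReal_re]; linarith [hδ.1]))
  refine ⟨∑' p : Nat.Primes, (p : ℝ) ^ (-2 : ℝ) + C, fun δ hδ ↦ ?_⟩
  have h1 := abs_tsum_primes_sub_log_norm_LFunction_le χ hδ.1
  have h2 := hC δ ⟨hδ.1.le, hδ.2⟩
  have h3 := abs_add_le (∑' p : Nat.Primes, (χ p).re * (p : ℝ) ^ (-(1 + δ)) -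
      Real.log ‖DirichletCharacter.LFunction χ (1 + δ : ℝ)‖)
    (Real.log ‖DirichletCharacter.LFunction χ (1 + δ : ℝ)‖)
  rw [sub_add_cancel] at h3
  exact h3.trans (add_le_add h1 h2)

lemma exists_abs_tsum_primes_rpow_add_log_le :
    ∃ C, ∀ δ ∈ Set.Ioc (0 : ℝ) 1,
      |∑' p : Nat.Primes, (p : ℝ) ^ (-(1 + δ)) + Real.log δ| ≤ C := by
  set F := DirichletCharacter.LFunctionTrivChar₁ 1 with hF
  have hFe : ∀ δ : ℝ, 0 < δ → F (1 + δ : ℝ) =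
      δ * DirichletCharacter.LFunction (1 : DirichletCharacter ℂ 1) (1 + δ : ℝ) := by
    intro δ hδ
    have : ((1 + δ : ℝ) : ℂ) ≠ 1 := by
      intro h
      have := congrArg Complex.re h
      simp at this; linarith
    rw [hF, DirichletCharacter.LFunctionTrivChar₁, Function.update_of_ne this,
      DirichletCharacter.LFunctionTrivChar]
    push_cast; ring
  have hL : ∀ δ : ℝ, 0 < δ →
      DirichletCharacter.LFunction (1 : DirichletCharacter ℂ 1) (1 + δ : ℝ) ≠ 0 := fun δ hδ ↦
    DirichletCharacter.LFunction_ne_zero_of_one_le_re _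
      (.inr fun h ↦ by
        have := congrArg Complex.re h
        simp at this; linarith)
      (by rw [Complex.ofReal_re]; linarith)
  obtain ⟨C, hC⟩ := exists_abs_log_norm_le (F := fun δ ↦ F (1 + δ : ℝ))
    ((DirichletCharacter.differentiable_LFunctionTrivChar₁ 1).continuous.comp
      (by fun_prop)).continuousOn
    (fun δ hδ ↦ by
      rcases hδ.1.eq_or_lt with rfl | h
      · rw [add_zero, Complex.ofReal_one]
        exact DirichletCharacter.LFunctionTrivChar₁_apply_one_ne_zero 1
      · rw [hFe δ h]
        exact mul_ne_zero (by exact_mod_cast h.ne') (hL δ h))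
  refine ⟨∑' p : Nat.Primes, (p : ℝ) ^ (-2 : ℝ) + C, fun δ hδ ↦ ?_⟩
  have h1 := abs_tsum_primes_sub_log_norm_LFunction_le (1 : DirichletCharacter ℂ 1) hδ.1
  have h2 := hC δ ⟨hδ.1.le, hδ.2⟩
  simp only [hFe δ hδ.1] at h2
  rw [norm_mul, Real.log_mul (by simpa using hδ.1.ne') (norm_ne_zero_iff.2 (hL δ hδ.1)),
    Complex.norm_real, Real.norm_of_nonneg hδ.1.le] at h2
  have hone : ∀ p : Nat.Primes, ((1 : DirichletCharacter ℂ 1) p).re = 1 := fun p ↦ by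
    rw [MulChar.one_apply (isUnit_of_subsingleton _), Complex.one_re]
  simp only [hone, one_mul] at h1
  have h3 := abs_add_le _ _ |>.trans (add_le_add h1 h2)
  refine (congrArg abs ?_).trans_le h3
  ring

lemma rpow_sub_rpow_half_ge {p δ : ℝ} (hp : 0 < p) :
    δ / 2 * (Real.log p * p ^ (-(1 + δ))) ≤ p ^ (-(1 + δ / 2)) - p ^ (-(1 + δ)) := by
  have h1 : p ^ (-(1 + δ / 2)) = p ^ (-(1 + δ)) * Real.exp (Real.log p * (δ / 2)) := by
    rw [← Real.rpow_def_of_pos hp, ← Real.rpow_add hp]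
    congr 1; ring
  rw [h1]
  have h2 := Real.add_one_le_exp (Real.log p * (δ / 2))
  have h3 : 0 < p ^ (-(1 + δ)) := Real.rpow_pos_of_pos hp _
  nlinarith

lemma summable_log_mul_rpow_primes {δ : ℝ} (hδ : 0 < δ) :
    Summable fun p : Nat.Primes ↦ Real.log p * (p : ℝ) ^ (-(1 + δ)) := by
  have h := ((Nat.Primes.summable_rpow_neg_one_add (half_pos hδ)).sub
    (Nat.Primes.summable_rpow_neg_one_add hδ)).mul_left (2 / δ)
  refine h.of_nonneg_of_le (fun p ↦ mul_nonneg (Real.log_natCast_nonneg _) (by positivity))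
    fun p ↦ ?_
  have := rpow_sub_rpow_half_ge (p := p) (δ := δ) (by exact_mod_cast p.2.pos)
  calc _ = 2 / δ * (δ / 2 * (Real.log p * (p : ℝ) ^ (-(1 + δ)))) := by field_simp
    _ ≤ _ := by gcongr

lemma exists_mul_tsum_log_mul_rpow_primes_le :
    ∃ C, ∀ δ ∈ Set.Ioc (0 : ℝ) 1,
      δ * ∑' p : Nat.Primes, Real.log p * (p : ℝ) ^ (-(1 + δ)) ≤ C := by
  obtain ⟨C, hC⟩ := exists_abs_tsum_primes_rpow_add_log_le
  refine ⟨2 * (2 * C + Real.log 2), fun δ hδ ↦ ?_⟩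
  have hδ2 : δ / 2 ∈ Set.Ioc (0 : ℝ) 1 := ⟨half_pos hδ.1, by linarith [hδ.2, hδ.1]⟩
  have h1 := abs_le.1 (hC δ hδ)
  have h2 := abs_le.1 (hC (δ / 2) hδ2)
  rw [Real.log_div hδ.1.ne' two_ne_zero] at h2
  have hs1 := Nat.Primes.summable_rpow_neg_one_add hδ.1
  have hs2 := Nat.Primes.summable_rpow_neg_one_add hδ2.1
  have h3 : δ / 2 * ∑' p : Nat.Primes, Real.log p * (p : ℝ) ^ (-(1 + δ)) ≤
      ∑' p : Nat.Primes, (p : ℝ) ^ (-(1 + δ / 2)) - ∑' p : Nat.Primes, (p : ℝ) ^ (-(1 + δ)) := by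
    rw [← tsum_mul_left, ← hs2.tsum_sub hs1]
    exact ((summable_log_mul_rpow_primes hδ.1).mul_left _).tsum_le_tsum
      (fun p ↦ rpow_sub_rpow_half_ge (by exact_mod_cast p.2.pos)) (hs2.sub hs1)
  linarith [h1.1, h2.2]

/-- The primes up to `y`. -/
noncomputable def primesUpTo (y : ℝ) : Finset ℕ := {p ∈ Finset.range (⌊y⌋₊ + 1) | p.Prime}

lemma mem_primesUpTo {y : ℝ} {p : ℕ} : p ∈ primesUpTo y ↔ p.Prime ∧ (p : ℝ) ≤ y := by
  rw [primesUpTo, Finset.mem_filter, Finset.mem_range, Nat.lt_succ_iff, and_comm]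
  exact and_congr_right fun h ↦ Nat.le_floor_iff' h.ne_zero

lemma sum_primesUpTo_eq_tsum (g : ℕ → ℝ) (y : ℝ) :
    HasSum (fun p : Nat.Primes ↦ if (p : ℝ) ≤ y then g p else 0) (∑ p ∈ primesUpTo y, g p) := by
  have h : ∑ p ∈ primesUpTo y, g p =
      ∑ p ∈ (primesUpTo y).subtype Nat.Prime, (if (p : ℝ) ≤ y then g p else 0) := by
    rw [Finset.sum_subtype_of_mem (p := Nat.Prime)
      (fun p : ℕ ↦ if (p : ℝ) ≤ y then g p else 0) (fun p hp ↦ (mem_primesUpTo.1 hp).1)]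
    exact Finset.sum_congr rfl fun p hp ↦ by rw [if_pos (mem_primesUpTo.1 hp).2]
  rw [h]
  refine hasSum_sum_of_ne_finset_zero fun p hp ↦ ?_
  exact if_neg fun hle ↦ hp (Finset.mem_subtype.2 (mem_primesUpTo.2 ⟨p.2, hle⟩))

/-- Replacing the sharp cutoff `p ≤ x` by the weight `p ^ (-1 / log x)` changes prime sums
with bounded coefficients by a bounded amount. -/
lemma exists_abs_sum_primesUpTo_sub_tsum_le :
    ∃ C, ∀ c : ℕ → ℝ, (∀ p, |c p| ≤ 1) → ∀ x : ℝ, Real.exp 1 ≤ x →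
      |∑ p ∈ primesUpTo x, c p / p -
        ∑' p : Nat.Primes, c p * (p : ℝ) ^ (-(1 + (Real.log x)⁻¹))| ≤ C := by
  obtain ⟨C, hC⟩ := exists_mul_tsum_log_mul_rpow_primes_le
  refine ⟨Real.exp 1 * C, fun c hc x hxe ↦ ?_⟩
  have hx0 : 0 < x := (Real.exp_pos 1).trans_le hxe
  have hx : 1 ≤ Real.log x := (Real.le_log_iff_exp_le hx0).2 hxe
  set δ := (Real.log x)⁻¹ with hδ
  have hl0 : 0 < Real.log x := by linarith
  have hδ0 : 0 < δ := inv_pos.2 hl0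
  have hδ1 : δ ≤ 1 := inv_le_one_of_one_le₀ hx
  have hδl : δ * Real.log x = 1 := inv_mul_cancel₀ hl0.ne'
  have hsc : Summable fun p : Nat.Primes ↦ c p * (p : ℝ) ^ (-(1 + δ)) :=
    Summable.of_norm_bounded (Nat.Primes.summable_rpow_neg_one_add hδ0) fun p ↦ by
      rw [norm_mul, Real.norm_of_nonneg (by positivity : (0 : ℝ) ≤ (p : ℝ) ^ (-(1 + δ)))]
      exact mul_le_of_le_one_left (by positivity) (hc p)
  have hs := sum_primesUpTo_eq_tsum (fun p ↦ c p / p) x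
  have hl := (summable_log_mul_rpow_primes hδ0).hasSum.mul_left (Real.exp 1 * δ)
  rw [← hs.tsum_eq, ← hs.summable.tsum_sub hsc, ← Real.norm_eq_abs]
  refine (tsum_of_norm_bounded hl fun p ↦ ?_).trans ?_
  · have hp0 : (0 : ℝ) < p := by exact_mod_cast p.2.pos
    have hp1 : (1 : ℝ) ≤ p := by exact_mod_cast p.2.one_le
    have hlp : 0 ≤ Real.log p := Real.log_nonneg hp1
    have hr : 0 < (p : ℝ) ^ (-(1 + δ)) := by positivity
    split_ifs with h
    · have h1 : (c p / p : ℝ) = c p * ((p : ℝ) ^ (-(1 + δ)) * Real.exp (Real.log p * δ)) := by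
        rw [← Real.rpow_def_of_pos hp0, ← Real.rpow_add hp0, div_eq_mul_inv,
          ← Real.rpow_neg_one]
        congr 2; ring
      have hle : Real.log p * δ ≤ 1 := by
        rw [← hδl, mul_comm]
        gcongr
      have h2 : Real.exp (Real.log p * δ) - 1 ≤ Real.exp 1 * (Real.log p * δ) := by
        have h3 := Real.add_one_le_exp (-(Real.log p * δ))
        have h4 : Real.exp (Real.log p * δ) * Real.exp (-(Real.log p * δ)) = 1 := by
          rw [← Real.exp_add]; simp
        have h5 := Real.exp_le_exp.2 hle
        have h6 := Real.exp_pos (Real.log p * δ)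
        have h7 : 0 ≤ Real.log p * δ := by positivity
        nlinarith
      have h8 : 0 ≤ Real.exp (Real.log p * δ) - 1 := by
        have := Real.add_one_le_exp (Real.log p * δ)
        have h7 : 0 ≤ Real.log p * δ := by positivity
        linarith
      rw [h1, ← mul_sub, norm_mul, ← mul_sub_one, norm_mul, Real.norm_of_nonneg hr.le,
        Real.norm_of_nonneg h8, Real.norm_eq_abs]
      calc |c p| * ((p : ℝ) ^ (-(1 + δ)) * (Real.exp (Real.log p * δ) - 1))
          ≤ 1 * ((p : ℝ) ^ (-(1 + δ)) * (Real.exp 1 * (Real.log p * δ))) := by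
            gcongr
            exact hc p
        _ = _ := by ring
    · push Not at h
      have hlx : Real.log x ≤ Real.log p := Real.log_le_log hx0 h.le
      have h1 : 1 ≤ δ * Real.log p := by rw [← hδl]; gcongr
      have h2 : (1 : ℝ) ≤ Real.exp 1 := Real.one_le_exp (by norm_num)
      rw [zero_sub, norm_neg, norm_mul, Real.norm_of_nonneg hr.le, Real.norm_eq_abs]
      calc |c p| * (p : ℝ) ^ (-(1 + δ)) ≤ 1 * (p : ℝ) ^ (-(1 + δ)) := by gcongr; exact hc p
        _ ≤ (Real.exp 1 * (δ * Real.log p)) * (p : ℝ) ^ (-(1 + δ)) := by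
          gcongr
          nlinarith
        _ = _ := by ring
  · rw [mul_assoc]
    gcongr
    exact hC δ ⟨hδ0, hδ1⟩

/-- Mertens' second theorem. -/
theorem exists_abs_sum_one_div_primesUpTo_sub_loglog_le :
    ∃ C, ∀ x : ℝ, Real.exp 1 ≤ x →
      |∑ p ∈ primesUpTo x, (1 : ℝ) / p - Real.log (Real.log x)| ≤ C := by
  obtain ⟨C₁, h₁⟩ := exists_abs_sum_primesUpTo_sub_tsum_le
  obtain ⟨C₂, h₂⟩ := exists_abs_tsum_primes_rpow_add_log_le
  refine ⟨C₁ + C₂, fun x hxe ↦ ?_⟩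
  have hx : 1 ≤ Real.log x :=
    (Real.le_log_iff_exp_le ((Real.exp_pos 1).trans_le hxe)).2 hxe
  have e1 := h₁ (fun _ ↦ 1) (by simp) x hxe
  have e2 := h₂ (Real.log x)⁻¹ ⟨inv_pos.2 (by linarith), inv_le_one_of_one_le₀ hx⟩
  simp only [one_mul] at e1
  rw [Real.log_inv] at e2
  have h3 := abs_add_le _ _ |>.trans (add_le_add e1 e2)
  refine (congrArg abs ?_).trans_le h3
  ring

open scoped NumberTheorySymbols in
/-- The Mertens sum of a nonprincipal quadratic character is bounded. -/
theorem exists_abs_sum_jacobiSym_div_primesUpTo_le {a : ℤ} (ha : ¬ IsSquare a) :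
    ∃ C, ∀ x : ℝ, Real.exp 1 ≤ x → |∑ p ∈ primesUpTo x, (J(a | p) : ℝ) / p| ≤ C := by
  have ha0 : a ≠ 0 := by rintro rfl; exact ha ⟨0, by simp⟩
  have : NeZero (4 * a.natAbs) := ⟨by omega⟩
  set χ := jacobiCharacter a ha0
  obtain ⟨C₁, h₁⟩ := exists_abs_sum_primesUpTo_sub_tsum_le
  obtain ⟨C₂, h₂⟩ := exists_abs_tsum_primes_dirichletCharacter_le (jacobiCharacter_ne_one ha ha0)
  set S := (2 * a.natAbs).divisors
  refine ⟨C₁ + C₂ + 2 * S.card, fun x hxe ↦ ?_⟩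
  have hx : 1 ≤ Real.log x :=
    (Real.le_log_iff_exp_le ((Real.exp_pos 1).trans_le hxe)).2 hxe
  have hχ1 : ∀ p : ℕ, |(χ p).re| ≤ 1 := fun p ↦
    (Complex.abs_re_le_norm _).trans (χ.norm_le_one _)
  have hJ1 : ∀ p : ℕ, |(J(a | p) : ℝ)| ≤ 1 := fun p ↦ by
    rcases jacobiSym.trichotomy a p with h | h | h <;> simp [h]
  have e1 := h₁ (fun p ↦ (χ p).re) hχ1 x hxe
  have e2 := h₂ (Real.log x)⁻¹ ⟨inv_pos.2 (by linarith), inv_le_one_of_one_le₀ hx⟩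
  have e3 : |∑ p ∈ primesUpTo x, ((J(a | p) : ℝ) / p - (χ p).re / p)| ≤ 2 * S.card := by
    have hterm : ∀ p ∈ primesUpTo x, |(J(a | p) : ℝ) / p - (χ p).re / p| ≤
        if p ∈ S then 2 else 0 := by
      intro p hp
      have hpp := (mem_primesUpTo.1 hp).1
      split_ifs with h
      · have hp1 : (1 : ℝ) ≤ p := by exact_mod_cast hpp.one_le
        rw [← sub_div, abs_div, Nat.abs_cast]
        refine (div_le_self (abs_nonneg _) hp1).trans ((abs_sub _ _).trans ?_)
        linarith [hJ1 p, hχ1 p]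
      · have hnd : ¬ p ∣ 2 * a.natAbs := fun hd ↦
          h (Nat.mem_divisors.2 ⟨hd, by omega⟩)
        have hodd : Odd p := hpp.odd_of_ne_two (by rintro rfl; exact hnd (dvd_mul_right _ _))
        have hcop : p.Coprime a.natAbs :=
          (Nat.Prime.coprime_iff_not_dvd hpp).2 fun hd ↦ hnd (hd.mul_left _)
        have : (χ p).re = (J(a | p) : ℝ) := by
          rw [jacobiCharacter_apply ha0 hodd hcop, Complex.intCast_re]
        rw [this, sub_self, abs_zero]
    refine (Finset.abs_sum_le_sum_abs _ _).trans ((Finset.sum_le_sum hterm).trans ?_)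
    rw [← Finset.sum_filter, Finset.sum_const, nsmul_eq_mul, mul_comm]
    gcongr
    exact fun p hp ↦ (Finset.mem_filter.1 hp).2
  rw [Finset.sum_sub_distrib] at e3
  have h3 := (abs_add_le _ _).trans (add_le_add ((abs_add_le _ _).trans (add_le_add e1 e2)) e3)
  refine (congrArg abs ?_).trans_le h3
  ring

lemma summable_one_div_primes_sq : Summable fun p : Nat.Primes ↦ 1 / (p : ℝ) ^ 2 := by
  refine (Nat.Primes.summable_rpow.2 (by norm_num : (-2 : ℝ) < -1)).congr fun p ↦ ?_
  rw [Real.rpow_neg (by positivity), one_div]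
  norm_cast

lemma sum_one_div_sq_primesUpTo_le (y : ℝ) :
    ∑ p ∈ primesUpTo y, 1 / (p : ℝ) ^ 2 ≤ ∑' p : Nat.Primes, 1 / (p : ℝ) ^ 2 := by
  have h := sum_primesUpTo_eq_tsum (fun p ↦ 1 / (p : ℝ) ^ 2) y
  rw [← h.tsum_eq]
  refine h.summable.tsum_le_tsum (fun p ↦ ?_) summable_one_div_primes_sq
  split_ifs
  · exact le_rfl
  · positivity

lemma norm_exp_ofReal_mul_I_sub_one_le (u : ℝ) : ‖Complex.exp (u * Complex.I) - 1‖ ≤ |u| := by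
  rw [mul_comm]
  exact Real.norm_exp_I_mul_ofReal_sub_one_le

/-- The value `exp (i τ f p)` at `p` of the twist of a real function `f`. -/
noncomputable def twist (τ : ℝ) (f : ℕ → ℝ) (p : ℕ) : ℂ := Complex.exp ((τ * f p : ℝ) * Complex.I)

lemma norm_twist (τ : ℝ) (f : ℕ → ℝ) (p : ℕ) : ‖twist τ f p‖ = 1 :=
  Complex.norm_exp_ofReal_mul_I _

lemma norm_twist_sub_one_le (τ : ℝ) {f : ℕ → ℝ} (hf : ∀ p, |f p| ≤ 1) (p : ℕ) :
    ‖twist τ f p - 1‖ ≤ |τ| :=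
  (norm_exp_ofReal_mul_I_sub_one_le _).trans <| by
    rw [abs_mul]; exact mul_le_of_le_one_right (abs_nonneg _) (hf p)

/-- The multiplicative function attached to `twist τ f`, supported on integers that are squarefree
with respect to the primes up to `y`. -/
noncomputable def truncatedTwist (τ : ℝ) (f : ℕ → ℝ) (y : ℝ) (n : ℕ) : ℂ :=
  ∏ p ∈ primesUpTo y, localFactor (fun p ↦ twist τ f p - 1) (fun p ↦ -twist τ f p) p n

lemma localFactor_twist (τ : ℝ) (f : ℕ → ℝ) (p n : ℕ) :
    localFactor (fun p ↦ twist τ f p - 1) (fun p ↦ -twist τ f p) p n =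
      if p ^ 2 ∣ n then 0 else if p ∣ n then twist τ f p else 1 := by
  rw [localFactor]
  by_cases h2 : p ^ 2 ∣ n
  · have h1 : p ∣ n := (Dvd.intro_left p (by ring)).trans h2
    simp [h1, h2]
  · by_cases h1 : p ∣ n <;> simp [h1, h2]

theorem norm_sum_truncatedTwist_sub_le (τ : ℝ) {f : ℕ → ℝ} (hf : ∀ p, |f p| ≤ 1) {x y : ℝ}
    (hx : 0 < x) (hy : Real.exp 1 ≤ y) :
    ‖∑ n ∈ Finset.Ioc 0 ⌊x⌋₊, truncatedTwist τ f y n -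
        x * ∏ p ∈ primesUpTo y, (1 + (twist τ f p - 1) / p + -twist τ f p / p ^ 2)‖ ≤
      x * Real.exp (-(Real.log x / Real.log y) + |τ| * Real.exp 1 * ∑ p ∈ primesUpTo y, 1 / (p : ℝ)
        + Real.exp 1 ^ 2 * ∑' p : Nat.Primes, 1 / (p : ℝ) ^ 2) := by
  have hy0 : 0 < y := (Real.exp_pos 1).trans_le hy
  have hly : 1 ≤ Real.log y := (Real.le_log_iff_exp_le hy0).2 hy
  have hly0 : 0 < Real.log y := by linarith
  set ε := (Real.log y)⁻¹ with hε
  have h := norm_sum_prod_localFactor_sub_le (fun p ↦ twist τ f p - 1) (fun p ↦ -twist τ f p)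
    (ε := ε) (by positivity) (inv_le_one_of_one_le₀ hly) (primesUpTo y)
    (fun p hp ↦ (mem_primesUpTo.1 hp).1) hx.le
  refine h.trans ?_
  have hpow : ∀ p ∈ primesUpTo y, (p : ℝ) ^ (ε - 1) ≤ Real.exp 1 * (1 / p) := by
    intro p hp
    obtain ⟨hpp, hpy⟩ := mem_primesUpTo.1 hp
    have hp0 : (0 : ℝ) < p := by exact_mod_cast hpp.pos
    rw [Real.rpow_sub_one hp0.ne', div_eq_mul_one_div]
    gcongr
    rw [Real.rpow_def_of_pos hp0, Real.exp_le_exp, hε]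
    calc Real.log p * (Real.log y)⁻¹ ≤ Real.log y * (Real.log y)⁻¹ := by
          gcongr
      _ = 1 := mul_inv_cancel₀ hly0.ne'
  have hprod : ∏ p ∈ primesUpTo y, (1 + ‖twist τ f p - 1‖ * (p : ℝ) ^ (ε - 1) +
      ‖-twist τ f p‖ * ((p : ℝ) ^ (ε - 1)) ^ 2) ≤
      Real.exp (|τ| * Real.exp 1 * ∑ p ∈ primesUpTo y, 1 / (p : ℝ)
        + Real.exp 1 ^ 2 * ∑' p : Nat.Primes, 1 / (p : ℝ) ^ 2) := by
    calc _ ≤ ∏ p ∈ primesUpTo y,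
          Real.exp (|τ| * Real.exp 1 * (1 / (p : ℝ)) + Real.exp 1 ^ 2 * (1 / (p : ℝ) ^ 2)) := by
          refine Finset.prod_le_prod (fun p _ ↦ by positivity) fun p hp ↦ ?_
          rw [norm_neg, norm_twist, one_mul]
          have h1 := hpow p hp
          have h2 : ((p : ℝ) ^ (ε - 1)) ^ 2 ≤ (Real.exp 1 * (1 / p)) ^ 2 := by gcongr
          have h3 : ‖twist τ f p - 1‖ * (p : ℝ) ^ (ε - 1) ≤ |τ| * (Real.exp 1 * (1 / p)) := by
            gcongr
            exact norm_twist_sub_one_le τ hf p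
          have h4 := Real.add_one_le_exp
            (|τ| * Real.exp 1 * (1 / (p : ℝ)) + Real.exp 1 ^ 2 * (1 / (p : ℝ) ^ 2))
          rw [mul_pow, one_div, inv_pow] at h2
          rw [one_div, one_div] at h4 ⊢
          rw [one_div] at h3
          linarith
      _ = Real.exp (|τ| * Real.exp 1 * ∑ p ∈ primesUpTo y, 1 / (p : ℝ)
        + Real.exp 1 ^ 2 * ∑ p ∈ primesUpTo y, 1 / (p : ℝ) ^ 2) := by
          rw [← Real.exp_sum, Finset.sum_add_distrib, Finset.mul_sum, Finset.mul_sum]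
      _ ≤ _ := by
          gcongr
          exact sum_one_div_sq_primesUpTo_le y
  have hxp : x ^ (1 - ε) = x * Real.exp (-(Real.log x / Real.log y)) := by
    rw [sub_eq_add_neg, Real.rpow_add hx, Real.rpow_one, Real.rpow_def_of_pos hx, hε]
    congr 2; ring
  rw [hxp, add_assoc, Real.exp_add, ← mul_assoc]
  gcongr

lemma primeFactors_eq_filter_primesUpTo {x : ℝ} {n : ℕ} (hn : n ∈ Finset.Ioc 0 ⌊x⌋₊) :
    n.primeFactors = {p ∈ primesUpTo x | p ∣ n} := by
  obtain ⟨h0, hx⟩ := Finset.mem_Ioc.1 hn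
  ext p
  rw [Nat.mem_primeFactors_of_ne_zero h0.ne', Finset.mem_filter, mem_primesUpTo]
  refine ⟨fun ⟨hp, hd⟩ ↦ ⟨⟨hp, ?_⟩, hd⟩, fun ⟨⟨hp, _⟩, hd⟩ ↦ ⟨hp, hd⟩⟩
  exact (Nat.le_floor_iff' hp.ne_zero).1 ((Nat.le_of_dvd h0 hd).trans hx)

lemma truncatedTwist_eq_zero {τ : ℝ} {f : ℕ → ℝ} {y : ℝ} {n p : ℕ} (hp : p ∈ primesUpTo y)
    (h : p ^ 2 ∣ n) : truncatedTwist τ f y n = 0 :=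
  Finset.prod_eq_zero hp (by rw [localFactor_twist, if_pos h])

lemma truncatedTwist_eq_exp {τ : ℝ} {f : ℕ → ℝ} {y : ℝ} {n : ℕ}
    (h : ∀ p ∈ primesUpTo y, ¬ p ^ 2 ∣ n) :
    truncatedTwist τ f y n =
      Complex.exp ((τ * ∑ p ∈ primesUpTo y with p ∣ n, f p : ℝ) * Complex.I) := by
  rw [truncatedTwist, Finset.prod_congr rfl fun p hp ↦ by
    rw [localFactor_twist, if_neg (h p hp)], ← Finset.prod_filter, Finset.mul_sum,
    Complex.ofReal_sum, Finset.sum_mul, Complex.exp_sum]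
  rfl

open scoped Classical in
lemma norm_exp_sub_truncatedTwist_le (τ : ℝ) {f : ℕ → ℝ} (hf : ∀ p, |f p| ≤ 1) {x y : ℝ}
    (hyx : y ≤ x) {n : ℕ} (hn : n ∈ Finset.Ioc 0 ⌊x⌋₊) :
    ‖(if Squarefree n then Complex.exp ((τ * ∑ p ∈ n.primeFactors, f p : ℝ) * Complex.I) else 0) -
        truncatedTwist τ f y n‖ ≤
      |τ| * ∑ p ∈ primesUpTo x \ primesUpTo y, (if p ∣ n then 1 else 0) +
        ∑ p ∈ primesUpTo x \ primesUpTo y, (if p ^ 2 ∣ n then 1 else 0) := by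
  have hn0 : 0 < n := (Finset.mem_Ioc.1 hn).1
  have hsub : primesUpTo y ⊆ primesUpTo x := fun p hp ↦
    mem_primesUpTo.2 ⟨(mem_primesUpTo.1 hp).1, (mem_primesUpTo.1 hp).2.trans hyx⟩
  have hn1 : (0 : ℝ) ≤ ∑ p ∈ primesUpTo x \ primesUpTo y, (if p ∣ n then 1 else 0) :=
    Finset.sum_nonneg fun p _ ↦ by split_ifs <;> norm_num
  have hn2 : (0 : ℝ) ≤ ∑ p ∈ primesUpTo x \ primesUpTo y, (if p ^ 2 ∣ n then 1 else 0) :=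
    Finset.sum_nonneg fun p _ ↦ by split_ifs <;> norm_num
  by_cases hsq : Squarefree n
  · have hno : ∀ p ∈ primesUpTo y, ¬ p ^ 2 ∣ n := fun p hp hd ↦
      (mem_primesUpTo.1 hp).1.one_lt.ne' (Nat.isUnit_iff.1 (hsq p (by rwa [← sq])))
    rw [if_pos hsq, truncatedTwist_eq_exp hno, primeFactors_eq_filter_primesUpTo hn]
    set S := ∑ p ∈ primesUpTo y with p ∣ n, f p
    set D := ∑ p ∈ primesUpTo x \ primesUpTo y with p ∣ n, f p with hD
    have hS : ∑ p ∈ primesUpTo x with p ∣ n, f p = S + D := by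
      rw [hD, Finset.sum_filter, Finset.sum_filter, ← Finset.sum_sdiff hsub, add_comm]
      rw [← Finset.sum_filter]
    have hDle : |D| ≤ ∑ p ∈ primesUpTo x \ primesUpTo y, (if p ∣ n then 1 else 0) := by
      rw [← Finset.sum_filter]
      exact (Finset.abs_sum_le_sum_abs _ _).trans (Finset.sum_le_sum fun p _ ↦ hf p)
    have hfac : Complex.exp ((τ * (S + D) : ℝ) * Complex.I) -
        Complex.exp ((τ * S : ℝ) * Complex.I) =
        Complex.exp ((τ * S : ℝ) * Complex.I) * (Complex.exp ((τ * D : ℝ) * Complex.I) - 1) := by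
      rw [mul_sub, mul_one, ← Complex.exp_add]
      congr 2
      push_cast; ring
    rw [hS, hfac, norm_mul, Complex.norm_exp_ofReal_mul_I, one_mul]
    refine (norm_exp_ofReal_mul_I_sub_one_le _).trans ?_
    rw [abs_mul]
    have := mul_le_mul_of_nonneg_left hDle (abs_nonneg τ)
    linarith
  · rw [if_neg hsq, zero_sub, norm_neg]
    by_cases hex : ∃ p ∈ primesUpTo y, p ^ 2 ∣ n
    · obtain ⟨p, hp, hd⟩ := hex
      rw [truncatedTwist_eq_zero hp hd, norm_zero]
      positivity
    · push Not at hex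
      rw [truncatedTwist_eq_exp hex, Complex.norm_exp_ofReal_mul_I]
      rw [Nat.squarefree_iff_prime_squarefree] at hsq
      push Not at hsq
      obtain ⟨q, hq, hd⟩ := hsq
      rw [← sq] at hd
      have hqx : q ∈ primesUpTo x := by
        have : q ∈ n.primeFactors :=
          Nat.mem_primeFactors.2 ⟨hq, (Dvd.intro_left q (by ring)).trans hd, hn0.ne'⟩
        rw [primeFactors_eq_filter_primesUpTo hn] at this
        exact (Finset.mem_filter.1 this).1
      have hmem : q ∈ primesUpTo x \ primesUpTo y :=
        Finset.mem_sdiff.2 ⟨hqx, fun h ↦ hex q h hd⟩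
      have h1 : (1 : ℝ) ≤ ∑ p ∈ primesUpTo x \ primesUpTo y, (if p ^ 2 ∣ n then 1 else 0) := by
        calc (1 : ℝ) = if q ^ 2 ∣ n then 1 else 0 := by rw [if_pos hd]
          _ ≤ _ := Finset.single_le_sum (f := fun p ↦ if p ^ 2 ∣ n then (1 : ℝ) else 0)
            (fun p _ ↦ by split_ifs <;> norm_num) hmem
      have := mul_nonneg (abs_nonneg τ) hn1
      linarith

lemma sum_Ioc_ite_dvd_one_le {m : ℕ} (hm : 0 < m) {x : ℝ} (hx : 0 ≤ x) :
    ∑ n ∈ Finset.Ioc 0 ⌊x⌋₊, (if m ∣ n then (1 : ℝ) else 0) ≤ x / m := by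
  rw [sum_Ioc_ite_dvd (fun _ ↦ (1 : ℝ)) hm, Finset.sum_const, Nat.card_Ioc, nsmul_eq_mul, mul_one,
    tsub_zero]
  exact Nat.cast_div_le.trans (by gcongr; exact Nat.floor_le hx)

open scoped Classical in
/-- The primes beyond `y` contribute little to the twisted count of squarefree integers. -/
theorem norm_sum_squarefree_exp_sub_truncatedTwist_le (τ : ℝ) {f : ℕ → ℝ} (hf : ∀ p, |f p| ≤ 1)
    {x y : ℝ} (hy : 0 < y) (hyx : y ≤ x) :
    ‖∑ n ∈ Finset.Ioc 0 ⌊x⌋₊ with Squarefree n,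
          Complex.exp ((τ * ∑ p ∈ n.primeFactors, f p : ℝ) * Complex.I) -
        ∑ n ∈ Finset.Ioc 0 ⌊x⌋₊, truncatedTwist τ f y n‖ ≤
      x * ((|τ| + 1 / y) *
        (∑ p ∈ primesUpTo x, 1 / (p : ℝ) - ∑ p ∈ primesUpTo y, 1 / (p : ℝ))) := by
  have hx : 0 < x := hy.trans_le hyx
  have hsub : primesUpTo y ⊆ primesUpTo x := fun p hp ↦
    mem_primesUpTo.2 ⟨(mem_primesUpTo.1 hp).1, (mem_primesUpTo.1 hp).2.trans hyx⟩
  rw [Finset.sum_filter, ← Finset.sum_sub_distrib]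
  refine (norm_sum_le _ _).trans ((Finset.sum_le_sum fun n hn ↦
    norm_exp_sub_truncatedTwist_le τ hf hyx hn).trans ?_)
  rw [Finset.sum_add_distrib, ← Finset.mul_sum, Finset.sum_comm,
    Finset.sum_comm (s := Finset.Ioc 0 ⌊x⌋₊),
    ← Finset.sum_sdiff hsub (f := fun p : ℕ ↦ 1 / (p : ℝ)), add_sub_cancel_right]
  have hpos : ∀ p ∈ primesUpTo x \ primesUpTo y, 0 < p ∧ y < p := by
    intro p hp
    obtain ⟨h1, h2⟩ := Finset.mem_sdiff.1 hp
    have hpp := (mem_primesUpTo.1 h1).1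
    exact ⟨hpp.pos, not_le.1 fun h ↦ h2 (mem_primesUpTo.2 ⟨hpp, h⟩)⟩
  have e1 : ∑ p ∈ primesUpTo x \ primesUpTo y,
      ∑ n ∈ Finset.Ioc 0 ⌊x⌋₊, (if p ∣ n then (1 : ℝ) else 0) ≤
      x * ∑ p ∈ primesUpTo x \ primesUpTo y, 1 / (p : ℝ) := by
    rw [Finset.mul_sum]
    refine Finset.sum_le_sum fun p hp ↦ ?_
    rw [mul_one_div]
    exact sum_Ioc_ite_dvd_one_le (hpos p hp).1 hx.le
  have e2 : ∑ p ∈ primesUpTo x \ primesUpTo y,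
      ∑ n ∈ Finset.Ioc 0 ⌊x⌋₊, (if p ^ 2 ∣ n then (1 : ℝ) else 0) ≤
      x * (1 / y * ∑ p ∈ primesUpTo x \ primesUpTo y, 1 / (p : ℝ)) := by
    rw [Finset.mul_sum, Finset.mul_sum]
    refine Finset.sum_le_sum fun p hp ↦ ?_
    obtain ⟨hp0, hyp⟩ := hpos p hp
    have hp0' : (0 : ℝ) < p := by exact_mod_cast hp0
    refine (sum_Ioc_ite_dvd_one_le (pow_pos hp0 2) hx.le).trans ?_
    rw [Nat.cast_pow, sq, div_eq_mul_one_div, one_div_mul_one_div]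
    gcongr
  have e3 := mul_le_mul_of_nonneg_left e1 (abs_nonneg τ)
  calc _ ≤ _ := add_le_add e3 e2
    _ = _ := by ring

lemma twist_local_factorization (h : ℂ) {p : ℕ} (hp : p ≠ 0) :
    1 + (h - 1) / p + -h / p ^ 2 = (1 - 1 / (p : ℂ) ^ 2) * (1 + (h - 1) / (p + 1)) := by
  have h0 : (p : ℂ) ≠ 0 := by exact_mod_cast hp
  have h1 : (p : ℂ) + 1 ≠ 0 := by exact_mod_cast p.succ_ne_zero
  field_simp
  ring

lemma exp_le_prod_one_sub_one_div_sq (y : ℝ) :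
    Real.exp (-(2 * ∑' p : Nat.Primes, 1 / (p : ℝ) ^ 2)) ≤
      ∏ p ∈ primesUpTo y, (1 - 1 / (p : ℝ) ^ 2) := by
  calc _ ≤ Real.exp (∑ p ∈ primesUpTo y, -(2 * (1 / (p : ℝ) ^ 2))) := by
        rw [Real.exp_le_exp, Finset.sum_neg_distrib, ← Finset.mul_sum]
        have := sum_one_div_sq_primesUpTo_le y
        linarith
    _ ≤ _ := by
        rw [Real.exp_sum]
        refine Finset.prod_le_prod (fun p _ ↦ (Real.exp_pos _).le) fun p hp ↦ ?_
        have h2 : (2 : ℝ) ≤ p := by exact_mod_cast (mem_primesUpTo.1 hp).1.two_le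
        set u := 1 / (p : ℝ) ^ 2 with hu
        have hu0 : 0 ≤ u := by positivity
        have hu1 : u ≤ 1 / 4 := by
          rw [hu]; exact one_div_le_one_div_of_le (by norm_num) (by nlinarith)
        have h := Real.add_one_le_exp (2 * u)
        rw [Real.exp_neg, inv_le_comm₀ (Real.exp_pos _) (by linarith)]
        refine le_trans ?_ h
        rw [inv_le_iff_one_le_mul₀ (by linarith)]
        nlinarith

lemma norm_twist_sub_one_sub_le {τ : ℝ} (hτ : |τ| ≤ 1) {f : ℕ → ℝ} (hf : ∀ p, |f p| ≤ 1) (p : ℕ) :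
    ‖twist τ f p - 1 - (τ * f p * Complex.I - τ ^ 2 / 2 * f p ^ 2)‖ ≤ |τ| ^ 3 := by
  have hn : ‖((τ * f p : ℝ) : ℂ) * Complex.I‖ ≤ |τ| := by
    rw [norm_mul, Complex.norm_I, mul_one, Complex.norm_real, Real.norm_eq_abs, abs_mul]
    exact mul_le_of_le_one_right (abs_nonneg _) (hf p)
  have h := Complex.exp_bound (hn.trans hτ) (n := 3) (by norm_num)
  have e : ∑ m ∈ Finset.range 3, (((τ * f p : ℝ) : ℂ) * Complex.I) ^ m / (m.factorial : ℂ) =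
      1 + (τ * f p * Complex.I - τ ^ 2 / 2 * f p ^ 2) := by
    simp only [Finset.sum_range_succ, Finset.sum_range_zero, Nat.factorial]
    push_cast
    ring_nf
    rw [Complex.I_sq]
    ring
  rw [e] at h
  rw [sub_sub, twist]
  refine h.trans ?_
  calc _ ≤ |τ| ^ 3 * 1 := by
        gcongr
        norm_num [Nat.factorial]
    _ = _ := mul_one _

lemma twist_one_add_eq_exp {τ : ℝ} (hτ : |τ| ≤ 1) {f : ℕ → ℝ} (hf : ∀ p, |f p| ≤ 1) {p : ℕ}
    (hp : 0 < p) :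
    ∃ E : ℂ, 1 + (twist τ f p - 1) / (p + 1) = Complex.exp E ∧
      ‖E - (τ * f p * Complex.I - τ ^ 2 / 2 * f p ^ 2) / p‖ ≤
        2 * |τ| * (1 / (p : ℝ) ^ 2) + |τ| ^ 3 * (1 / (p : ℝ)) := by
  have hp1 : (1 : ℝ) ≤ p := by exact_mod_cast hp
  have hp0 : (0 : ℝ) < p := by linarith
  have hn1 : ‖(p : ℂ) + 1‖ = p + 1 := by
    have : (p : ℂ) + 1 = ((p + 1 : ℕ) : ℂ) := by push_cast; ring
    rw [this, Complex.norm_natCast]; push_cast; ring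
  have hc0 : (p : ℂ) ≠ 0 := by exact_mod_cast hp.ne'
  have hc1 : (p : ℂ) + 1 ≠ 0 := by exact_mod_cast p.succ_ne_zero
  set h := twist τ f p with hh
  set w := (h - 1) / ((p : ℂ) + 1) with hw
  have hnh : ‖h - 1‖ ≤ |τ| := norm_twist_sub_one_le τ hf p
  have hwp : ‖w‖ ≤ |τ| / (p + 1) := by
    rw [hw, norm_div, hn1]; gcongr
  have hw2 : ‖w‖ ≤ 1 / 2 := hwp.trans (div_le_div₀ zero_le_one hτ (by norm_num) (by linarith))
  have hwp' : ‖w‖ ≤ |τ| / p := hwp.trans (by gcongr; linarith)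
  have hne : 1 + w ≠ 0 := by
    intro h0
    have : w = -1 := by linear_combination h0
    rw [this, norm_neg, norm_one] at hw2
    norm_num at hw2
  refine ⟨Complex.log (1 + w), (Complex.exp_log hne).symm, ?_⟩
  have a1 : ‖Complex.log (1 + w) - w‖ ≤ |τ| * (1 / (p : ℝ) ^ 2) := by
    refine (Complex.norm_log_one_add_sub_self_le (by linarith)).trans ?_
    have hi : (1 - ‖w‖)⁻¹ ≤ 2 := by
      rw [inv_le_comm₀ (by linarith) (by norm_num)]; linarith
    calc _ ≤ ‖w‖ ^ 2 * 2 / 2 := by gcongr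
      _ = ‖w‖ ^ 2 := by ring
      _ ≤ (|τ| / p) ^ 2 := by gcongr
      _ = |τ| * (|τ| * (1 / (p : ℝ) ^ 2)) := by ring
      _ ≤ |τ| * (1 * (1 / (p : ℝ) ^ 2)) := by gcongr
      _ = _ := by ring
  have a2 : ‖w - (h - 1) / p‖ ≤ |τ| * (1 / (p : ℝ) ^ 2) := by
    have : w - (h - 1) / p = -((h - 1) / (p * (p + 1))) := by
      rw [hw]; field_simp; ring
    rw [this, norm_neg, norm_div, norm_mul, hn1, Complex.norm_natCast, mul_one_div]
    gcongr
    nlinarith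
  have a3 : ‖(h - 1) / p - (τ * f p * Complex.I - τ ^ 2 / 2 * f p ^ 2) / p‖ ≤
      |τ| ^ 3 * (1 / (p : ℝ)) := by
    rw [← sub_div, norm_div, Complex.norm_natCast, mul_one_div]
    gcongr
    exact norm_twist_sub_one_sub_le hτ hf p
  have := (norm_add_le _ _).trans (add_le_add ((norm_add_le _ _).trans (add_le_add a1 a2)) a3)
  calc _ = _ := by congr 1; ring
    _ ≤ _ := this
    _ = _ := by ring

/-- The Euler product attached to `twist τ f`, up to `y`, in exponential form. -/
theorem prod_twist_eq_exp {τ : ℝ} (hτ : |τ| ≤ 1) {f : ℕ → ℝ} (hf : ∀ p, |f p| ≤ 1) (y : ℝ) :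
    ∃ E : ℂ, ∏ p ∈ primesUpTo y, (1 + (twist τ f p - 1) / p + -twist τ f p / p ^ 2) =
        (∏ p ∈ primesUpTo y, (1 - 1 / (p : ℝ) ^ 2) : ℝ) * Complex.exp E ∧
      ‖E - ((τ * ∑ p ∈ primesUpTo y, f p / p : ℝ) * Complex.I -
          (τ ^ 2 / 2 * ∑ p ∈ primesUpTo y, f p ^ 2 / p : ℝ))‖ ≤
        2 * |τ| * (∑' p : Nat.Primes, 1 / (p : ℝ) ^ 2) +
          |τ| ^ 3 * ∑ p ∈ primesUpTo y, 1 / (p : ℝ) := by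
  have hpos : ∀ p ∈ primesUpTo y, 0 < p := fun p hp ↦ (mem_primesUpTo.1 hp).1.pos
  have hex : ∀ p : ℕ, ∃ E : ℂ, 0 < p → 1 + (twist τ f p - 1) / (p + 1) = Complex.exp E ∧
      ‖E - (τ * f p * Complex.I - τ ^ 2 / 2 * f p ^ 2) / p‖ ≤
        2 * |τ| * (1 / (p : ℝ) ^ 2) + |τ| ^ 3 * (1 / (p : ℝ)) := fun p ↦ by
    rcases p.eq_zero_or_pos with rfl | hp
    · exact ⟨0, fun h ↦ absurd h (lt_irrefl 0)⟩
    · obtain ⟨E, hE⟩ := twist_one_add_eq_exp hτ hf hp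
      exact ⟨E, fun _ ↦ hE⟩
  choose E hE using hex
  refine ⟨∑ p ∈ primesUpTo y, E p, ?_, ?_⟩
  · rw [Complex.exp_sum, Complex.ofReal_prod, ← Finset.prod_mul_distrib]
    refine Finset.prod_congr rfl fun p hp ↦ ?_
    rw [twist_local_factorization _ (hpos p hp).ne', (hE p (hpos p hp)).1]
    push_cast; ring
  · have e : ((τ * ∑ p ∈ primesUpTo y, f p / p : ℝ) : ℂ) * Complex.I -
          ((τ ^ 2 / 2 * ∑ p ∈ primesUpTo y, f p ^ 2 / p : ℝ) : ℂ) =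
        ∑ p ∈ primesUpTo y, ((τ * f p * Complex.I - τ ^ 2 / 2 * f p ^ 2) / p : ℂ) := by
      push_cast
      rw [Finset.mul_sum, Finset.mul_sum, Finset.sum_mul, ← Finset.sum_sub_distrib]
      refine Finset.sum_congr rfl fun p _ ↦ ?_
      ring
    rw [e, ← Finset.sum_sub_distrib]
    refine (norm_sum_le _ _).trans
      ((Finset.sum_le_sum fun p hp ↦ (hE p (hpos p hp)).2).trans ?_)
    rw [Finset.sum_add_distrib, ← Finset.mul_sum, ← Finset.mul_sum]
    gcongr
    exact sum_one_div_sq_primesUpTo_le y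

open Filter Topology in
lemma tendsto_inv_sqrt_atTop : Tendsto (fun l : ℝ ↦ (√l)⁻¹) atTop (𝓝 0) :=
  Real.tendsto_sqrt_atTop.inv_tendsto_atTop

open Filter Topology in
lemma tendsto_log_mul_inv_sqrt_atTop :
    Tendsto (fun l : ℝ ↦ Real.log l * (√l)⁻¹) atTop (𝓝 0) := by
  have h := (isLittleO_log_rpow_atTop (r := 1 / 2) (by norm_num)).tendsto_div_nhds_zero
  refine h.congr fun l ↦ ?_
  rw [← Real.sqrt_eq_rpow, div_eq_mul_inv]

open Filter Topology in
lemma tendsto_sieve_error (a b c : ℝ) :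
    Tendsto (fun l : ℝ ↦ Real.exp (-l + a * (√l)⁻¹ * Real.exp 1 * (l + b) + c) +
      (a * (√l)⁻¹ + l * Real.exp (-l)) * (Real.log l + 2 * b)) atTop (𝓝 0) := by
  have hs := tendsto_inv_sqrt_atTop
  have hl := tendsto_log_mul_inv_sqrt_atTop
  have hi : Tendsto (fun l : ℝ ↦ l⁻¹) atTop (𝓝 0) := tendsto_inv_atTop_zero
  have h1 : Tendsto (fun l : ℝ ↦ -1 + a * (√l)⁻¹ * Real.exp 1 * (1 + b * l⁻¹) + c * l⁻¹)
      atTop (𝓝 (-1)) := by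
    have := (((hs.const_mul a).mul_const (Real.exp 1)).mul ((hi.const_mul b).const_add 1)).const_add
      (-1) |>.add (hi.const_mul c)
    simpa using this
  have h2 : Tendsto (fun l : ℝ ↦ -l + a * (√l)⁻¹ * Real.exp 1 * (l + b) + c) atTop atBot := by
    refine (tendsto_id.atTop_mul_neg (by norm_num) h1).congr' ?_
    filter_upwards [eventually_gt_atTop 0] with l hl0
    simp only [id]
    field_simp
  have h3 : Tendsto (fun l : ℝ ↦ a * (Real.log l * (√l)⁻¹) + a * (√l)⁻¹ * (2 * b)) atTop (𝓝 0) := by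
    simpa using (hl.const_mul a).add ((hs.const_mul a).mul_const (2 * b))
  have hexp1 : Tendsto (fun l : ℝ ↦ l * Real.exp (-l)) atTop (𝓝 0) := by
    simpa using Real.tendsto_pow_mul_exp_neg_atTop_nhds_zero 1
  have hexp2 : Tendsto (fun l : ℝ ↦ l ^ 2 * Real.exp (-l)) atTop (𝓝 0) :=
    Real.tendsto_pow_mul_exp_neg_atTop_nhds_zero 2
  have h4 : Tendsto (fun l : ℝ ↦ l * Real.exp (-l) * Real.log l) atTop (𝓝 0) := by
    refine squeeze_zero' ?_ ?_ hexp2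
    · filter_upwards [eventually_ge_atTop 1] with l hl1
      have := Real.log_nonneg hl1
      positivity
    · filter_upwards [eventually_ge_atTop 1] with l hl1
      have := (Real.log_le_sub_one_of_pos (by linarith : 0 < l))
      calc _ ≤ l * Real.exp (-l) * l := by gcongr; linarith
        _ = _ := by ring
  have h5 := ((Real.tendsto_exp_atBot.comp h2).add h3).add (h4.add (hexp1.mul_const (2 * b)))
  simp only [zero_add, zero_mul] at h5
  refine h5.congr fun l ↦ ?_
  simp only [Function.comp]
  ring

/-- The sum of `exp (i τ g(n))` over squarefree `n ≤ x`, where `g` is the additive function with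
values `f p` at primes. -/
noncomputable def squarefreeExpSum (f : ℕ → ℝ) (τ x : ℝ) : ℂ :=
  open scoped Classical in
  ∑ n ∈ Finset.Ioc 0 ⌊x⌋₊ with Squarefree n,
    Complex.exp ((τ * ∑ p ∈ n.primeFactors, f p : ℝ) * Complex.I)

/-- The Euler product approximating `squarefreeExpSum f τ x / x`. -/
noncomputable def twistProduct (f : ℕ → ℝ) (τ y : ℝ) : ℂ :=
  ∏ p ∈ primesUpTo y, (1 + (twist τ f p - 1) / p + -twist τ f p / p ^ 2)

/-- The sifting level used for primes dividing integers up to `x`. -/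
noncomputable def siftLevel (x : ℝ) : ℝ := Real.exp (Real.log x / Real.log (Real.log x))

open Filter in
lemma tendsto_loglog_atTop : Tendsto (fun x : ℝ ↦ Real.log (Real.log x)) atTop atTop :=
  Real.tendsto_log_atTop.comp Real.tendsto_log_atTop

lemma log_siftLevel (x : ℝ) :
    Real.log (siftLevel x) = Real.log x / Real.log (Real.log x) := Real.log_exp _

lemma loglog_siftLevel {x : ℝ} (h : 1 ≤ Real.log (Real.log x)) (hx : 0 < Real.log x) :
    Real.log (Real.log (siftLevel x)) =
      Real.log (Real.log x) - Real.log (Real.log (Real.log x)) := by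
  rw [log_siftLevel, Real.log_div hx.ne' (by linarith)]

lemma siftLevel_bounds {x : ℝ} (hx : 0 < Real.log x) (h : 1 ≤ Real.log (Real.log x)) (hx0 : 0 < x) :
    Real.exp 1 ≤ siftLevel x ∧ siftLevel x ≤ x ∧
      1 / siftLevel x ≤ Real.log (Real.log x) * Real.exp (-Real.log (Real.log x)) := by
  set l := Real.log (Real.log x) with hl
  have hlx : Real.log x = Real.exp l := (Real.exp_log hx).symm
  have h1 := Real.add_one_le_exp l
  have hlog : Real.log x / l = Real.exp l / l := by rw [hlx]
  refine ⟨?_, ?_, ?_⟩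
  · rw [siftLevel, Real.exp_le_exp, ← hl, hlog, le_div_iff₀ (by linarith)]
    linarith
  · calc siftLevel x ≤ Real.exp (Real.log x) := by
          rw [siftLevel, Real.exp_le_exp, ← hl]
          exact div_le_self hx.le h
      _ = x := Real.exp_log hx0
  · rw [siftLevel, ← hl, hlog]
    have h2 := Real.add_one_le_exp (Real.exp l / l)
    have h3 : 0 < Real.exp l / l := div_pos (Real.exp_pos _) (by linarith)
    calc 1 / Real.exp (Real.exp l / l) ≤ 1 / (Real.exp l / l) := by gcongr; linarith
      _ = _ := by rw [one_div_div, Real.exp_neg, div_eq_mul_inv]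

open Filter Topology in
/-- Twisted sums over squarefree integers are approximated by an Euler product. -/
theorem tendsto_squarefreeExpSum_div_sub_twistProduct {f : ℕ → ℝ} (hf : ∀ p, |f p| ≤ 1) (s : ℝ) :
    Tendsto (fun x : ℝ ↦ squarefreeExpSum f (s * (√(Real.log (Real.log x)))⁻¹) x / x -
      twistProduct f (s * (√(Real.log (Real.log x)))⁻¹) (siftLevel x)) atTop (𝓝 0) := by
  obtain ⟨C, hC⟩ := exists_abs_sum_one_div_primesUpTo_sub_loglog_le
  set K := ∑' p : Nat.Primes, 1 / (p : ℝ) ^ 2 with hK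
  refine squeeze_zero_norm' ?_
    ((tendsto_sieve_error |s| C (Real.exp 1 ^ 2 * K)).comp tendsto_loglog_atTop)
  filter_upwards [eventually_ge_atTop (Real.exp 1), eventually_gt_atTop 0,
    tendsto_loglog_atTop.eventually_ge_atTop 1,
    Real.tendsto_log_atTop.eventually_gt_atTop 0] with x hxe hx0 hll hlx
  obtain ⟨hy1, hy2, hy3⟩ := siftLevel_bounds hlx hll hx0
  have hlly := loglog_siftLevel hll hlx
  have hy0 : 0 < siftLevel x := (Real.exp_pos _).trans_le hy1
  have hdiv : Real.log x / Real.log (siftLevel x) = Real.log (Real.log x) := by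
    rw [log_siftLevel, div_div_cancel₀ hlx.ne']
  simp only [Function.comp]
  set l := Real.log (Real.log x) with hl
  set y := siftLevel x with hy
  set τ := s * (√l)⁻¹ with hτ
  have hτa : |τ| = |s| * (√l)⁻¹ := by
    rw [hτ, abs_mul, abs_of_nonneg (inv_nonneg.2 (Real.sqrt_nonneg l))]
  have e1 := norm_sum_squarefree_exp_sub_truncatedTwist_le τ hf hy0 hy2
  have e2 := norm_sum_truncatedTwist_sub_le τ hf hx0 hy1
  have c1 := abs_le.1 (hC x hxe)
  have c2 := abs_le.1 (hC y hy1)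
  rw [hlly] at c2
  rw [hdiv] at e2
  have hlogl : 0 ≤ Real.log l := Real.log_nonneg hll
  have e3 := (norm_add_le _ _).trans (add_le_add e1 e2)
  rw [sub_add_sub_cancel] at e3
  have hxc : (x : ℂ) ≠ 0 := by exact_mod_cast hx0.ne'
  have e4 : squarefreeExpSum f τ x / x - twistProduct f τ y =
      (squarefreeExpSum f τ x - x * twistProduct f τ y) / x := by
    field_simp
  rw [e4, norm_div, Complex.norm_real, Real.norm_of_nonneg hx0.le, div_le_iff₀ hx0]
  refine e3.trans ?_
  rw [← mul_add, mul_comm, hτa, add_comm]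
  gcongr
  · linarith [c2.2]
  · exact sub_nonneg.2 (Finset.sum_le_sum_of_subset_of_nonneg (fun p hp ↦
      mem_primesUpTo.2 ⟨(mem_primesUpTo.1 hp).1, (mem_primesUpTo.1 hp).2.trans hy2⟩)
      fun _ _ _ ↦ by positivity)
  · linarith [c1.2, c2.1]

open Filter Topology in
lemma tendsto_gaussian_error (a K C₀ C b : ℝ) :
    Tendsto (fun l : ℝ ↦ 2 * (a * (√l)⁻¹) * K + (a * (√l)⁻¹) ^ 3 * (l + C₀) + a * (√l)⁻¹ * C +
      (a * (√l)⁻¹) ^ 2 / 2 * C + b * (Real.log l / l)) atTop (𝓝 0) := by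
  have hs := tendsto_inv_sqrt_atTop
  have hl := tendsto_log_mul_inv_sqrt_atTop
  have h := (((((hs.const_mul a).const_mul 2).mul_const K).add
    ((((hs.const_mul (a ^ 3)).add (((hs.const_mul a).pow 3).mul_const C₀))))).add
    ((hs.const_mul a).mul_const C)).add ((((hs.const_mul a).pow 2).div_const 2).mul_const C)
    |>.add ((hl.mul hs).const_mul b)
  simp only [mul_zero, zero_mul, add_zero, ne_eq, OfNat.ofNat_ne_zero, not_false_eq_true, zero_pow,
    zero_div] at h
  refine h.congr' ?_
  filter_upwards [eventually_gt_atTop 0] with l hl0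
  have h2 : (√l)⁻¹ ^ 2 = l⁻¹ := by rw [inv_pow, Real.sq_sqrt hl0.le]
  have h3 : (√l)⁻¹ ^ 3 = l⁻¹ * (√l)⁻¹ := by rw [pow_succ, h2]
  have h4 : (√l)⁻¹ * (√l)⁻¹ = l⁻¹ := by rw [← sq, h2]
  rw [mul_pow, h3, mul_assoc (Real.log l), h4]
  field_simp

open Filter Topology in
theorem tendsto_twistProduct_div {f : ℕ → ℝ} (hf : ∀ p, |f p| ≤ 1) {C V : ℝ}
    (hS₁ : ∀ x : ℝ, Real.exp 1 ≤ x → |∑ p ∈ primesUpTo x, f p / p| ≤ C)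
    (hS₂ : ∀ x : ℝ, Real.exp 1 ≤ x →
      |∑ p ∈ primesUpTo x, f p ^ 2 / p - V * Real.log (Real.log x)| ≤ C) (s : ℝ) :
    Tendsto (fun x : ℝ ↦ twistProduct f (s * (√(Real.log (Real.log x)))⁻¹) (siftLevel x) /
        (∏ p ∈ primesUpTo (siftLevel x), (1 - 1 / (p : ℝ) ^ 2) : ℝ)) atTop
      (𝓝 (Complex.exp (-(s ^ 2 * V / 2 : ℝ)))) := by
  obtain ⟨C₀, hC₀⟩ := exists_abs_sum_one_div_primesUpTo_sub_loglog_le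
  set K := ∑' p : Nat.Primes, 1 / (p : ℝ) ^ 2 with hK
  have hτ1 : ∀ᶠ x : ℝ in atTop, |s * (√(Real.log (Real.log x)))⁻¹| ≤ 1 := by
    have h := (tendsto_inv_sqrt_atTop.comp tendsto_loglog_atTop).const_mul s
    rw [mul_zero] at h
    filter_upwards [h.abs.eventually_lt_const (u := 1) (by simp)] with x hx
    exact hx.le
  have hQ : ∀ y, (∏ p ∈ primesUpTo y, (1 - 1 / (p : ℝ) ^ 2)) ≠ 0 := fun y ↦
    ((Real.exp_pos _).trans_le (exp_le_prod_one_sub_one_div_sq y)).ne'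
  have hE : ∀ x : ℝ, ∃ E : ℂ, |s * (√(Real.log (Real.log x)))⁻¹| ≤ 1 →
      twistProduct f (s * (√(Real.log (Real.log x)))⁻¹) (siftLevel x) /
        (∏ p ∈ primesUpTo (siftLevel x), (1 - 1 / (p : ℝ) ^ 2) : ℝ) = Complex.exp E ∧ _ := fun x ↦ by
    by_cases h : |s * (√(Real.log (Real.log x)))⁻¹| ≤ 1
    · obtain ⟨E, h1, h2⟩ := prod_twist_eq_exp h hf (siftLevel x)
      refine ⟨E, fun _ ↦ ⟨?_, h2⟩⟩
      rw [twistProduct, h1, mul_div_cancel_left₀]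
      exact_mod_cast hQ _
    · exact ⟨0, fun h' ↦ absurd h' h⟩
  choose E hE using hE
  have key : Tendsto (fun x ↦ E x) atTop (𝓝 (-(s ^ 2 * V / 2 : ℝ))) := by
    rw [tendsto_iff_norm_sub_tendsto_zero]
    refine squeeze_zero' (.of_forall fun x ↦ norm_nonneg _) ?_
      ((tendsto_gaussian_error |s| K C₀ C (|s ^ 2 * V| / 2)).comp tendsto_loglog_atTop)
    filter_upwards [hτ1, eventually_gt_atTop 0, tendsto_loglog_atTop.eventually_ge_atTop 1,
      Real.tendsto_log_atTop.eventually_gt_atTop 0] with x hτ hx0 hll hlx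
    obtain ⟨hy1, -, -⟩ := siftLevel_bounds hlx hll hx0
    have hlly := loglog_siftLevel hll hlx
    have hEx := (hE x hτ).2
    simp only [Function.comp]
    set l := Real.log (Real.log x) with hl
    set y := siftLevel x with hy
    set τ := s * (√l)⁻¹ with hτdef
    have hτa : |τ| = |s| * (√l)⁻¹ := by
      rw [hτdef, abs_mul, abs_of_nonneg (inv_nonneg.2 (Real.sqrt_nonneg l))]
    have hl0 : 0 < l := by linarith
    have hτ2 : τ ^ 2 = s ^ 2 * l⁻¹ := by
      rw [hτdef, mul_pow, inv_pow, Real.sq_sqrt hl0.le]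
    have hlogl : 0 ≤ Real.log l := Real.log_nonneg hll
    have b1 := hS₁ y hy1
    have b2 := hS₂ y hy1
    have b0 := (abs_le.1 (hC₀ y hy1)).2
    rw [hlly] at b2 b0
    set S₁ := ∑ p ∈ primesUpTo y, f p / p
    set S₂ := ∑ p ∈ primesUpTo y, f p ^ 2 / p
    have d1 : ‖((τ * S₁ : ℝ) : ℂ) * Complex.I‖ ≤ |τ| * C := by
      rw [norm_mul, Complex.norm_I, mul_one, Complex.norm_real, Real.norm_eq_abs, abs_mul]
      gcongr
    have d2 : ‖((τ ^ 2 / 2 * (V * (l - Real.log l) - S₂) : ℝ) : ℂ)‖ ≤ |τ| ^ 2 / 2 * C := by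
      rw [Complex.norm_real, Real.norm_eq_abs, abs_mul, sq_abs, abs_of_nonneg (a := τ ^ 2 / 2)
        (by positivity), abs_sub_comm]
      gcongr
    have d3 : ‖((s ^ 2 * V / 2 * (Real.log l / l) : ℝ) : ℂ)‖ ≤
        |s ^ 2 * V| / 2 * (Real.log l / l) := by
      rw [Complex.norm_real, Real.norm_eq_abs, abs_mul, abs_div, abs_two,
        abs_of_nonneg (a := Real.log l / l) (by positivity)]
    have d0 : 2 * |τ| * K + |τ| ^ 3 * ∑ p ∈ primesUpTo y, 1 / (p : ℝ) ≤
        2 * |τ| * K + |τ| ^ 3 * (l + C₀) := by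
      gcongr
      linarith
    have hsum := (norm_add_le _ _).trans (add_le_add ((norm_add_le _ _).trans (add_le_add
      ((norm_add_le _ _).trans (add_le_add (hEx.trans d0) d1)) d2)) d3)
    rw [← hτa]
    refine (congrArg norm ?_).trans_le hsum
    have hid : (τ ^ 2 / 2 * (V * (l - Real.log l) - S₂)) = s ^ 2 * V / 2 -
        s ^ 2 * V / 2 * (Real.log l / l) - τ ^ 2 / 2 * S₂ := by
      rw [mul_sub, hτ2]; field_simp
    rw [hid]
    push_cast
    ring
  refine (((Complex.continuous_exp.tendsto _).comp key)).congr' ?_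
  filter_upwards [hτ1] with x hx
  exact ((hE x hx).1).symm

open Filter Topology in
/-- Characteristic functions of a normalised additive function on squarefree integers converge to
a Gaussian one. -/
theorem tendsto_squarefreeExpSum_div {f : ℕ → ℝ} (hf : ∀ p, |f p| ≤ 1) {C V : ℝ}
    (hS₁ : ∀ x : ℝ, Real.exp 1 ≤ x → |∑ p ∈ primesUpTo x, f p / p| ≤ C)
    (hS₂ : ∀ x : ℝ, Real.exp 1 ≤ x →
      |∑ p ∈ primesUpTo x, f p ^ 2 / p - V * Real.log (Real.log x)| ≤ C) (s : ℝ) :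
    Tendsto (fun x : ℝ ↦ squarefreeExpSum f (s * (√(Real.log (Real.log x)))⁻¹) x /
        squarefreeExpSum f 0 x) atTop (𝓝 (Complex.exp (-(s ^ 2 * V / 2 : ℝ)))) := by
  set c := Real.exp (-(2 * ∑' p : Nat.Primes, 1 / (p : ℝ) ^ 2)) with hc
  have hc0 : 0 < c := Real.exp_pos _
  set Q : ℝ → ℂ := fun x ↦ (∏ p ∈ primesUpTo (siftLevel x), (1 - 1 / (p : ℝ) ^ 2) : ℝ) with hQ
  have hQc : ∀ x, c ≤ ‖Q x‖ := fun x ↦ by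
    rw [hQ, Complex.norm_real]
    exact (exp_le_prod_one_sub_one_div_sq _).trans (le_abs_self _)
  have hQ0 : ∀ x, Q x ≠ 0 := fun x ↦ norm_pos_iff.1 (hc0.trans_le (hQc x))
  have hdivQ : ∀ g : ℝ → ℂ, Tendsto g atTop (𝓝 0) →
      Tendsto (fun x ↦ g x / Q x) atTop (𝓝 0) := fun g hg ↦ by
    refine squeeze_zero_norm (a := fun x ↦ ‖g x‖ / c) (fun x ↦ ?_) ?_
    · rw [norm_div]
      exact div_le_div_of_nonneg_left (norm_nonneg _) hc0 (hQc x)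
    · simpa using hg.norm.div_const c
  have main : ∀ s : ℝ, Tendsto (fun x : ℝ ↦
      squarefreeExpSum f (s * (√(Real.log (Real.log x)))⁻¹) x / x / Q x) atTop
      (𝓝 (Complex.exp (-(s ^ 2 * V / 2 : ℝ)))) := fun s ↦ by
    have h := (hdivQ _ (tendsto_squarefreeExpSum_div_sub_twistProduct hf s)).add
      (tendsto_twistProduct_div hf hS₁ hS₂ s)
    rw [zero_add] at h
    refine h.congr fun x ↦ ?_
    rw [← add_div, sub_add_cancel]
  have h0 := main 0
  simp only [zero_mul, ne_eq, OfNat.ofNat_ne_zero, not_false_eq_true, zero_pow, zero_div,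
    Complex.ofReal_zero, neg_zero, Complex.exp_zero] at h0
  have h := (main s).div h0 one_ne_zero
  rw [div_one] at h
  refine h.congr' ?_
  filter_upwards [eventually_gt_atTop 0] with x hx
  have hx' : (x : ℂ) ≠ 0 := by exact_mod_cast hx.ne'
  simp only [Pi.div_apply]
  rw [div_div_div_cancel_right₀ (hQ0 x), div_div_div_cancel_right₀ hx']

/-- The distribution of `F` under the uniform probability measure on `A`. -/
noncomputable def empiricalMeasure (A : Finset ℕ) (F : ℕ → ℝ) : MeasureTheory.Measure ℝ :=
  (A.card : ENNReal)⁻¹ • ∑ n ∈ A, MeasureTheory.Measure.dirac (F n)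

lemma empiricalMeasure_apply (A : Finset ℕ) (F : ℕ → ℝ) {s : Set ℝ} (hs : MeasurableSet s)
    [DecidablePred fun n ↦ F n ∈ s] :
    empiricalMeasure A F s = (A.card : ENNReal)⁻¹ * ({n ∈ A | F n ∈ s}.card : ENNReal) := by
  rw [empiricalMeasure, MeasureTheory.Measure.smul_apply, MeasureTheory.Measure.finsetSum_apply,
    smul_eq_mul]
  congr 1
  rw [Finset.card_filter, Nat.cast_sum]
  refine Finset.sum_congr rfl fun n _ ↦ ?_
  rw [MeasureTheory.Measure.dirac_apply' _ hs]
  by_cases h : F n ∈ s <;> simp [h]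

lemma isProbabilityMeasure_empiricalMeasure {A : Finset ℕ} (hA : A.Nonempty) (F : ℕ → ℝ) :
    MeasureTheory.IsProbabilityMeasure (empiricalMeasure A F) where
  measure_univ := by
    classical
    rw [empiricalMeasure_apply A F MeasurableSet.univ]
    simp only [Set.mem_univ, Finset.filter_true]
    exact ENNReal.inv_mul_cancel (by exact_mod_cast hA.card_pos.ne') (ENNReal.natCast_ne_top _)

lemma charFun_empiricalMeasure (A : Finset ℕ) (F : ℕ → ℝ) (t : ℝ) :
    MeasureTheory.charFun (empiricalMeasure A F) t =
      (∑ n ∈ A, Complex.exp ((t * F n : ℝ) * Complex.I)) / A.card := by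
  rw [MeasureTheory.charFun_apply_real, empiricalMeasure, MeasureTheory.integral_smul_measure,
    MeasureTheory.integral_finsetSum_measure]
  · simp only [MeasureTheory.integral_dirac, ENNReal.toReal_inv, ENNReal.toReal_natCast,
      Complex.ofReal_mul, Complex.real_smul, Complex.ofReal_inv, Complex.ofReal_natCast]
    rw [div_eq_inv_mul]
  · intro n _
    exact MeasureTheory.integrable_dirac (by simp)

lemma gaussianReal_Iic_toReal (z : ℝ) :
    (ProbabilityTheory.gaussianReal 0 1 (Set.Iic z)).toReal =
      (1 / √(2 * Real.pi)) * ∫ w in Set.Iic z, Real.exp (-(w ^ 2) / 2) := by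
  rw [ProbabilityTheory.gaussianReal_apply_eq_integral 0 one_ne_zero, ENNReal.toReal_ofReal
    (MeasureTheory.integral_nonneg fun w ↦ ProbabilityTheory.gaussianPDFReal_nonneg 0 1 w),
    ← MeasureTheory.integral_const_mul]
  simp [ProbabilityTheory.gaussianPDFReal]

open Filter Topology in
/-- Lévy's continuity theorem for distribution functions of values on finite sets. -/
theorem tendsto_card_filter_le_div_card {A : ℕ → Finset ℕ} {F : ℕ → ℕ → ℝ}
    (hA : ∀ k, (A k).Nonempty)
    (h : ∀ t : ℝ, Tendsto (fun k ↦ (∑ n ∈ A k, Complex.exp ((t * F k n : ℝ) * Complex.I)) /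
      (A k).card) atTop (𝓝 (Complex.exp (-(t ^ 2 / 2 : ℝ))))) (z : ℝ)
    [∀ k, DecidablePred fun n ↦ F k n ≤ z] :
    Tendsto (fun k ↦ (({n ∈ A k | F k n ≤ z}.card : ℕ) : ℝ) / (A k).card) atTop
      (𝓝 ((1 / √(2 * Real.pi)) * ∫ w in Set.Iic z, Real.exp (-(w ^ 2) / 2))) := by
  let μ : ℕ → MeasureTheory.ProbabilityMeasure ℝ := fun k ↦
    ⟨empiricalMeasure (A k) (F k), isProbabilityMeasure_empiricalMeasure (hA k) (F k)⟩
  let ν : MeasureTheory.ProbabilityMeasure ℝ :=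
    ⟨ProbabilityTheory.gaussianReal 0 1, inferInstance⟩
  have hμ : Tendsto μ atTop (𝓝 ν) := by
    refine MeasureTheory.ProbabilityMeasure.tendsto_of_tendsto_charFun fun t ↦ ?_
    have e : MeasureTheory.charFun (ν : MeasureTheory.Measure ℝ) t =
        Complex.exp (-(t ^ 2 / 2 : ℝ)) := by
      refine (ProbabilityTheory.charFun_gaussianReal t).trans ?_
      congr 1
      push_cast
      ring
    rw [e]
    exact (h t).congr fun k ↦ (charFun_empiricalMeasure (A k) (F k) t).symm
  have hz : (ν : MeasureTheory.Measure ℝ) (frontier (Set.Iic z)) = 0 := by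
    have := ProbabilityTheory.nullSingletonClass_gaussianReal (μ := 0) (v := 1) one_ne_zero
    rw [frontier_Iic]
    exact MeasureTheory.measure_singleton (μ := ProbabilityTheory.gaussianReal 0 1) z
  have hlim := MeasureTheory.ProbabilityMeasure.tendsto_measure_of_null_frontier_of_tendsto' hμ hz
  have hlim' := (ENNReal.tendsto_toReal (MeasureTheory.measure_ne_top _ _)).comp hlim
  rw [← gaussianReal_Iic_toReal]
  refine hlim'.congr fun k ↦ ?_
  have e := empiricalMeasure_apply (A k) (F k) (measurableSet_Iic (a := z))
  change (empiricalMeasure (A k) (F k) (Set.Iic z)).toReal = _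
  rw [e, ENNReal.toReal_mul, ENNReal.toReal_inv, ENNReal.toReal_natCast, ENNReal.toReal_natCast,
    div_eq_inv_mul]
  rfl

open Filter Topology in
open scoped Classical in
/-- An Erdős–Kac theorem for additive functions on squarefree integers whose values at primes are
bounded by one and have mean zero and variance `V`. -/
theorem tendsto_card_squarefree_le_div_card {f : ℕ → ℝ} (hf : ∀ p, |f p| ≤ 1) {C V : ℝ}
    (hV : 0 < V) (hS₁ : ∀ x : ℝ, Real.exp 1 ≤ x → |∑ p ∈ primesUpTo x, f p / p| ≤ C)
    (hS₂ : ∀ x : ℝ, Real.exp 1 ≤ x →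
      |∑ p ∈ primesUpTo x, f p ^ 2 / p - V * Real.log (Real.log x)| ≤ C) (z : ℝ) :
    Tendsto (fun x : ℝ ↦
      (({n ∈ Finset.range (⌊x⌋₊ + 1) | Squarefree n ∧
        ∑ p ∈ n.primeFactors, f p ≤ z * √(V * Real.log (Real.log x))}.card : ℕ) : ℝ) /
      ({n ∈ Finset.range (⌊x⌋₊ + 1) | Squarefree n}.card : ℕ)) atTop
      (𝓝 ((1 / √(2 * Real.pi)) * ∫ w in Set.Iic z, Real.exp (-(w ^ 2) / 2))) := by
  set B : ℝ → Finset ℕ := fun x ↦ {n ∈ Finset.range (⌊x⌋₊ + 1) | Squarefree n} with hB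
  have hB' : ∀ x, {n ∈ Finset.Ioc 0 ⌊x⌋₊ | Squarefree n} = B x := fun x ↦ by
    ext n
    simp only [hB, Finset.mem_filter, Finset.mem_Ioc, Finset.mem_range, Nat.lt_succ_iff]
    exact ⟨fun h ↦ ⟨h.1.2, h.2⟩, fun h ↦ ⟨⟨Nat.pos_of_ne_zero h.2.ne_zero, h.1⟩, h.2⟩⟩
  refine tendsto_of_seq_tendsto fun u hu ↦ ?_
  have hev : ∀ᶠ k in atTop, 1 ≤ u k ∧ 0 < Real.log (Real.log (u k)) :=
    (hu.eventually_ge_atTop 1).and ((tendsto_loglog_atTop.comp hu).eventually_gt_atTop 0)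
  obtain ⟨N, hN⟩ := eventually_atTop.1 hev
  rw [← tendsto_add_atTop_iff_nat N]
  have hu' : Tendsto (fun k ↦ u (k + N)) atTop atTop := (tendsto_add_atTop_iff_nat N).2 hu
  have key := tendsto_card_filter_le_div_card (A := fun k ↦ B (u (k + N)))
    (F := fun k n ↦ (∑ p ∈ n.primeFactors, f p) * (√(V * Real.log (Real.log (u (k + N)))))⁻¹)
    (fun k ↦ ⟨1, ?_⟩) (fun t ↦ ?_) z
  · refine key.congr fun k ↦ ?_
    have hpos : 0 < √(V * Real.log (Real.log (u (k + N)))) :=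
      Real.sqrt_pos.2 (mul_pos hV (hN _ (Nat.le_add_left N k)).2)
    simp only [Function.comp, hB, Finset.filter_filter, ← div_eq_mul_inv, div_le_iff₀ hpos]
  · simp only [hB, Finset.mem_filter, Finset.mem_range, squarefree_one, and_true]
    have := (Nat.one_le_floor_iff _).2 (hN _ (Nat.le_add_left N k)).1
    omega
  · have h := (tendsto_squarefreeExpSum_div hf hS₁ hS₂ (t * (√V)⁻¹)).comp hu'
    have e : (t * (√V)⁻¹) ^ 2 * V / 2 = t ^ 2 / 2 := by
      rw [mul_pow, inv_pow, Real.sq_sqrt hV.le]; field_simp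
    rw [e] at h
    refine h.congr fun k ↦ ?_
    simp only [Function.comp, squarefreeExpSum, hB']
    congr 1
    · refine Finset.sum_congr rfl fun n _ ↦ ?_
      rw [Real.sqrt_mul hV.le, mul_inv]
      congr 3
      ring
    · simp

section

open scoped NumberTheorySymbols

lemma abs_sum_div_primesUpTo_sub_le {g h : ℕ → ℝ} {m : ℕ} (hm : m ≠ 0)
    (hgh : ∀ p : ℕ, p.Prime → ¬ p ∣ m → g p = h p) (hg : ∀ p, |g p| ≤ 1) (hh : ∀ p, |h p| ≤ 1)
    (x : ℝ) :
    |∑ p ∈ primesUpTo x, g p / p - ∑ p ∈ primesUpTo x, h p / p| ≤ 2 * m.divisors.card := by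
  have hterm : ∀ p ∈ primesUpTo x, |g p / p - h p / p| ≤ if p ∈ m.divisors then 2 else 0 := by
    intro p hp
    have hpp := (mem_primesUpTo.1 hp).1
    split_ifs with hd
    · have hp1 : (1 : ℝ) ≤ p := by exact_mod_cast hpp.one_le
      rw [← sub_div, abs_div, Nat.abs_cast]
      refine (div_le_self (abs_nonneg _) hp1).trans ((abs_sub _ _).trans ?_)
      linarith [hg p, hh p]
    · rw [hgh p hpp fun h ↦ hd (Nat.mem_divisors.2 ⟨h, hm⟩), sub_self, abs_zero]
  rw [← Finset.sum_sub_distrib]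
  refine (Finset.abs_sum_le_sum_abs _ _).trans ((Finset.sum_le_sum hterm).trans ?_)
  rw [← Finset.sum_filter, Finset.sum_const, nsmul_eq_mul, mul_comm]
  gcongr
  exact fun p hp ↦ (Finset.mem_filter.1 hp).2

lemma abs_jacobiSym_le_one (a : ℤ) (n : ℕ) : |(J(a | n) : ℝ)| ≤ 1 := by
  rcases jacobiSym.trichotomy a n with h | h | h <;> simp [h]

open scoped Classical in
/-- The values at primes of the additive function comparing `J(a | ·)` with `J(b | ·)`. -/
noncomputable def jacobiHalfDiff (a b : ℤ) (p : ℕ) : ℝ :=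
  if Odd p ∧ ¬ (p : ℤ) ∣ b then ((J(a | p) : ℝ) - J(b | p)) / 2 else 0

lemma abs_jacobiHalfDiff_le_one (a b : ℤ) (p : ℕ) : |jacobiHalfDiff a b p| ≤ 1 := by
  rw [jacobiHalfDiff]
  split_ifs
  · have ha := abs_le.1 (abs_jacobiSym_le_one a p)
    have hb := abs_le.1 (abs_jacobiSym_le_one b p)
    exact abs_le.2 ⟨by linarith, by linarith⟩
  · simp

lemma jacobiHalfDiff_of_not_dvd (a : ℤ) {b : ℤ} {p : ℕ} (hp : p.Prime)
    (h : ¬ p ∣ 2 * b.natAbs) : jacobiHalfDiff a b p = ((J(a | p) : ℝ) - J(b | p)) / 2 := by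
  refine if_pos ⟨hp.odd_of_ne_two ?_, fun hd ↦ ?_⟩
  · rintro rfl
    exact h (dvd_mul_right _ _)
  · exact h ((Int.natCast_dvd.1 hd).mul_left 2)

lemma jacobiSym_sq_eq_one {a : ℤ} {p : ℕ} (hp : p.Prime) (h : ¬ p ∣ a.natAbs) :
    (J(a | p) : ℝ) ^ 2 = 1 := by
  have hgcd : a.gcd p = 1 := ((Nat.Prime.coprime_iff_not_dvd hp).2 h).symm
  exact_mod_cast jacobiSym.sq_one hgcd

theorem exists_abs_sum_jacobiHalfDiff_le {a b : ℤ} (ha : ¬ IsSquare a) (hb : ¬ IsSquare b) :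
    ∃ C, ∀ x : ℝ, Real.exp 1 ≤ x → |∑ p ∈ primesUpTo x, jacobiHalfDiff a b p / p| ≤ C := by
  obtain ⟨C₁, h₁⟩ := exists_abs_sum_jacobiSym_div_primesUpTo_le ha
  obtain ⟨C₂, h₂⟩ := exists_abs_sum_jacobiSym_div_primesUpTo_le hb
  have hb0 : 2 * b.natAbs ≠ 0 := by
    have : b ≠ 0 := by rintro rfl; exact hb ⟨0, by simp⟩
    omega
  refine ⟨2 * (2 * b.natAbs).divisors.card + (C₁ + C₂) / 2, fun x hx ↦ ?_⟩
  have h := abs_le.1 (abs_sum_div_primesUpTo_sub_le (g := jacobiHalfDiff a b)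
    (h := fun p ↦ ((J(a | p) : ℝ) - J(b | p)) / 2) hb0
    (fun p hp hd ↦ jacobiHalfDiff_of_not_dvd a hp hd) (abs_jacobiHalfDiff_le_one a b)
    (fun p ↦ abs_le.2 (by
      have ha := abs_le.1 (abs_jacobiSym_le_one a p)
      have hb := abs_le.1 (abs_jacobiSym_le_one b p)
      constructor <;> linarith)) x)
  have e : ∑ p ∈ primesUpTo x, ((J(a | p) : ℝ) - J(b | p)) / 2 / p =
      (∑ p ∈ primesUpTo x, (J(a | p) : ℝ) / p - ∑ p ∈ primesUpTo x, (J(b | p) : ℝ) / p) / 2 := by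
    rw [← Finset.sum_sub_distrib, Finset.sum_div]
    exact Finset.sum_congr rfl fun p _ ↦ by ring
  rw [e] at h
  have c1 := abs_le.1 (h₁ x hx)
  have c2 := abs_le.1 (h₂ x hx)
  exact abs_le.2 ⟨by linarith, by linarith⟩

theorem exists_abs_sum_jacobiHalfDiff_sq_sub_le {a b : ℤ} (hab : ¬ IsSquare (b * a)) :
    ∃ C, ∀ x : ℝ, Real.exp 1 ≤ x → |∑ p ∈ primesUpTo x, jacobiHalfDiff a b p ^ 2 / p -
      1 / 2 * Real.log (Real.log x)| ≤ C := by
  obtain ⟨C₁, h₁⟩ := exists_abs_sum_one_div_primesUpTo_sub_loglog_le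
  obtain ⟨C₂, h₂⟩ := exists_abs_sum_jacobiSym_div_primesUpTo_le hab
  have ha0 : a ≠ 0 := by rintro rfl; exact hab ⟨0, by simp⟩
  have hb0 : b ≠ 0 := by rintro rfl; exact hab ⟨0, by simp⟩
  have hm : 2 * b.natAbs * a.natAbs ≠ 0 :=
    mul_ne_zero (mul_ne_zero two_ne_zero (Int.natAbs_ne_zero.2 hb0)) (Int.natAbs_ne_zero.2 ha0)
  refine ⟨2 * (2 * b.natAbs * a.natAbs).divisors.card + (C₁ + C₂) / 2, fun x hx ↦ ?_⟩
  have h := abs_le.1 (abs_sum_div_primesUpTo_sub_le (g := fun p ↦ jacobiHalfDiff a b p ^ 2)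
    (h := fun p ↦ (1 - (J(b * a | p) : ℝ)) / 2) hm (fun p hp hd ↦ ?_)
    (fun p ↦ by
      rw [abs_pow]
      exact pow_le_one₀ (abs_nonneg _) (abs_jacobiHalfDiff_le_one a b p))
    (fun p ↦ abs_le.2 (by
      have := abs_le.1 (abs_jacobiSym_le_one (b * a) p)
      constructor <;> linarith)) x)
  · have e : ∑ p ∈ primesUpTo x, (1 - (J(b * a | p) : ℝ)) / 2 / p =
        (∑ p ∈ primesUpTo x, 1 / (p : ℝ) - ∑ p ∈ primesUpTo x, (J(b * a | p) : ℝ) / p) / 2 := by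
      rw [← Finset.sum_sub_distrib, Finset.sum_div]
      exact Finset.sum_congr rfl fun p _ ↦ by ring
    rw [e] at h
    have c1 := abs_le.1 (h₁ x hx)
    have c2 := abs_le.1 (h₂ x hx)
    exact abs_le.2 ⟨by linarith, by linarith⟩
  · have hda : ¬ p ∣ a.natAbs := fun h ↦ hd (h.mul_left _)
    have hdb : ¬ p ∣ 2 * b.natAbs := fun h ↦ hd (h.mul_right _)
    rw [jacobiHalfDiff_of_not_dvd a hp hdb, jacobiSym.mul_left]
    have e1 := jacobiSym_sq_eq_one hp hda
    have e2 := jacobiSym_sq_eq_one hp fun h ↦ hdb (h.mul_left 2)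
    push_cast
    linear_combination e1 / 4 + e2 / 4

end

open Filter Real
open scoped Classical

/-- normalized Gaussian distribution of g over squarefree numbers. -/
theorem legendre_additive_gaussian (Δ Δ' : ℤ)
    (h1 : ¬ IsSquare Δ) (h2 : ¬ IsSquare Δ') (h3 : ¬ IsSquare (Δ * Δ')) (z : ℝ) :
    Tendsto (fun x : ℝ =>
      (((Finset.range (⌊x⌋₊ + 1)).filter
          (fun n => Squarefree n ∧
            (∑ p ∈ n.primeFactors.filter (fun p => Odd p ∧ ¬ ((p : ℤ) ∣ Δ)),
              ((jacobiSym Δ' p : ℝ) - (jacobiSym Δ p : ℝ)) / 2)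
              ≤ z * Real.sqrt ((1 / 2) * Real.log (Real.log x)))).card : ℝ) /
      (((Finset.range (⌊x⌋₊ + 1)).filter (fun n => Squarefree n)).card : ℝ))
      atTop
      (nhds ((1 / Real.sqrt (2 * Real.pi)) *
        ∫ w in Set.Iic z, Real.exp (-(w ^ 2) / 2))) := by
  obtain ⟨C₁, hC₁⟩ := exists_abs_sum_jacobiHalfDiff_le h2 h1
  obtain ⟨C₂, hC₂⟩ := exists_abs_sum_jacobiHalfDiff_sq_sub_le h3
  have h := tendsto_card_squarefree_le_div_card (f := jacobiHalfDiff Δ' Δ) (C := max C₁ C₂)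
    (V := 1 / 2) (abs_jacobiHalfDiff_le_one Δ' Δ) (by norm_num)
    (fun x hx ↦ (hC₁ x hx).trans (le_max_left _ _))
    (fun x hx ↦ (hC₂ x hx).trans (le_max_right _ _)) z
  simp only [jacobiHalfDiff, ← Finset.sum_filter] at h
  convert h
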